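/- Let a be a negative squarefree integer such that 2 does not ramify in the ring of integers O of ℚ(√a) (equivalently, a ≡ 1 mod 4) and such that the class number of ℚ(√a) is at most 2 (for imaginary quadratic fields the narrow class number coincides with the class number). Let r be a prime such that p ≢ 1 (mod r) for every prime p dividing a. Then the set of positive integers k for which there exist z ∈ O and t ∈ ℤ with N_{ℚ(√a)/ℚ}(z) = t^r + k and t^r + k ≠ 0 has natural density 1. -/

import Mathlib

open Filter

open MeasureTheory AddCircle in
/-- The integral of a character over a small arc does not vanish. -/
theorem half_measureReal_le_norm_integral_fourier {ε : ℝ} {n : ℕ} (h : 2 * Real.pi * n * ε ≤ 1) :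
    haarAddCircle.real (Metric.closedBall (0 : UnitAddCircle) ε) / 2 ≤
      ‖∫ x in Metric.closedBall (0 : UnitAddCircle) ε, fourier (n : ℤ) x ∂haarAddCircle‖ := by
  refine le_trans ?_ (Complex.re_le_norm _)
  have hfour_int : Integrable (fun x : UnitAddCircle => fourier (n : ℤ) x)
      (haarAddCircle.restrict (Metric.closedBall (0 : UnitAddCircle) ε)) :=
    ((fourier (T := 1) (n : ℤ)).continuous.integrable_of_hasCompactSupport
      (HasCompactSupport.of_compactSpace _)).integrableOn
  have hre := integral_re hfour_int
  simp only [RCLike.re_to_complex] at hre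
  rw [← hre]
  have hle : ∀ x ∈ Metric.closedBall (0 : UnitAddCircle) ε,
      (1 / 2 : ℝ) ≤ (fourier (n : ℤ) x).re := by
    intro x hx
    induction x using QuotientAddGroup.induction_on with
    | H y =>
      have hy : |y - round y| ≤ ε := by
        rw [mem_closedBall_zero_iff] at hx
        rwa [← UnitAddCircle.norm_eq]
      have hcoe : ((QuotientAddGroup.mk y : UnitAddCircle)) = ((y - round y : ℝ) : UnitAddCircle) := by
        rw [AddCircle.coe_sub]
        have : (((round y : ℤ) : ℝ) : UnitAddCircle) = 0 := by
          rw [AddCircle.coe_eq_zero_iff]; exact ⟨round y, by simp⟩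
        rw [this, sub_zero]
      rw [hcoe, fourier_coe_apply]
      set z := y - round y
      have : (2 * Real.pi * Complex.I * ((n : ℤ) : ℂ) * (z : ℂ) / ((1 : ℝ) : ℂ)) =
          ((2 * Real.pi * n * z : ℝ) : ℂ) * Complex.I := by push_cast; ring
      rw [this, Complex.exp_ofReal_mul_I_re]
      refine le_trans ?_ (Real.one_sub_sq_div_two_le_cos)
      have habs : |2 * Real.pi * n * z| ≤ 1 := by
        rw [abs_mul, abs_of_nonneg (by positivity)]
        exact le_trans (mul_le_mul_of_nonneg_left hy (by positivity)) h
      have := (sq_le_one_iff_abs_le_one _).2 habs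
      linarith
  have hmono := setIntegral_mono_on (μ := haarAddCircle)
    (s := Metric.closedBall (0 : UnitAddCircle) ε)
    (f := fun _ => (1 / 2 : ℝ)) (integrable_const _).integrableOn hfour_int.re
    Metric.isClosed_closedBall.measurableSet hle
  simpa [div_eq_mul_inv] using hmono

open MeasureTheory AddCircle in
theorem integral_fourier_closedBall (θ : UnitAddCircle) (ε : ℝ) (n : ℤ) :
    ∫ x in Metric.closedBall θ ε, fourier n x ∂haarAddCircle =
      fourier n θ * ∫ x in Metric.closedBall (0 : UnitAddCircle) ε, fourier n x ∂haarAddCircle := by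
  rw [← integral_indicator Metric.isClosed_closedBall.measurableSet,
    ← integral_indicator Metric.isClosed_closedBall.measurableSet,
    ← integral_add_right_eq_self _ θ, ← integral_const_mul]
  congr 1
  ext x
  by_cases hx : x ∈ Metric.closedBall (0 : UnitAddCircle) ε
  · have : x + θ ∈ Metric.closedBall θ ε := by simpa using hx
    simp only [Set.indicator_of_mem this, Set.indicator_of_mem hx, fourier_apply, smul_add,
      AddCircle.toCircle_add, Circle.coe_mul]
    ring
  · have : x + θ ∉ Metric.closedBall θ ε := by simpa using hx
    simp only [Set.indicator_of_notMem this, Set.indicator_of_notMem hx, mul_zero]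

open MeasureTheory AddCircle ComplexConjugate in
/-- The analytic large sieve inequality, with a non-optimal constant. -/
theorem large_sieve {ι : Type*} (s : Finset ι) (θ : ι → ℝ) (c : ι → ℂ) {δ : ℝ} (hδ : 0 < δ)
    (hsep : ∀ i ∈ s, ∀ j ∈ s, i ≠ j → ∀ m : ℤ, δ ≤ |θ i - θ j - m|) (M : ℕ)
    (hM : 4 * M * δ ≤ 1) :
    ∑ n ∈ Finset.range M,
      ‖∑ i ∈ s, c i * Complex.exp (2 * Real.pi * Complex.I * (n * θ i))‖ ^ 2 ≤
      6 / δ * ∑ i ∈ s, ‖c i‖ ^ 2 := by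
  classical
  rcases Nat.eq_zero_or_pos M with rfl | hMpos
  · simp only [Finset.range_zero, Finset.sum_empty]; positivity
  have hδ1 : δ ≤ 1 / 2 := by
    have : (1 : ℝ) ≤ M := by exact_mod_cast hMpos
    nlinarith
  set ε : ℝ := δ / 3 with hε
  let μ : Measure UnitAddCircle := haarAddCircle
  let A : ι → Set UnitAddCircle := fun i => Metric.closedBall (θ i : UnitAddCircle) ε
  have hmeas : ∀ i, MeasurableSet (A i) := fun i => Metric.isClosed_closedBall.measurableSet
  have hball : ∀ x : UnitAddCircle, μ.real (Metric.closedBall x ε) = 2 * ε := by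
    intro x
    have h1 : (volume : Measure UnitAddCircle) = μ := by
      rw [AddCircle.volume_eq_smul_haarAddCircle]; simp [μ]
    rw [Measure.real, ← h1, AddCircle.volume_closedBall,
      min_eq_right (by rw [hε]; linarith), ENNReal.toReal_ofReal (by positivity)]
  have hdisj : ∀ i ∈ s, ∀ j ∈ s, i ≠ j → A i ∩ A j = ∅ := by
    intro i hi j hj hij
    rw [← Set.disjoint_iff_inter_eq_empty]
    apply Metric.closedBall_disjoint_closedBall
    rw [dist_eq_norm, ← AddCircle.coe_sub, UnitAddCircle.norm_eq]
    have := hsep i hi j hj hij (round (θ i - θ j))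
    rw [hε]; linarith
  let g : ι → Lp ℂ 2 μ := fun i => indicatorConstLp 2 (hmeas i) (measure_ne_top _ _) 1
  let G : Lp ℂ 2 μ := ∑ i ∈ s, conj (c i) • g i
  have hnormG : ‖G‖ ^ 2 = 2 * ε * ∑ i ∈ s, ‖c i‖ ^ 2 := by
    have : (inner ℂ G G : ℂ) = ((2 * ε * ∑ i ∈ s, ‖c i‖ ^ 2 : ℝ) : ℂ) := by
      simp only [G, sum_inner, inner_sum, inner_smul_left, inner_smul_right]
      push_cast
      rw [Finset.mul_sum]
      refine Finset.sum_congr rfl fun i hi => ?_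
      rw [Finset.sum_eq_single i]
      · have : (inner ℂ (g i) (g i) : ℂ) = ((2 * ε : ℝ) : ℂ) := by
          rw [L2.inner_indicatorConstLp_one_indicatorConstLp_one, Set.inter_self, hball]; rfl
        rw [this]
        have h2 : (c i) * conj (c i) = ((‖c i‖ : ℝ) : ℂ) ^ 2 := Complex.mul_conj' _
        simp only [Complex.conj_conj]
        push_cast
        linear_combination (2 * ε : ℂ) * h2
      · intro j hj hji
        have : (inner ℂ (g j) (g i) : ℂ) = 0 := by
          rw [L2.inner_indicatorConstLp_one_indicatorConstLp_one, hdisj j hj i hi hji]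
          simp
        simp [this]
      · intro h; exact absurd hi h
    have h3 := inner_self_eq_norm_sq_to_K (𝕜 := ℂ) G
    rw [this] at h3
    exact Complex.ofReal_injective (by rw [h3]; push_cast; rfl)
  have hbessel := Orthonormal.sum_inner_products_le (𝕜 := ℂ)
    (v := fun n : ℕ => fourierLp (T := 1) 2 (n : ℤ)) (s := Finset.range M) G
    ((orthonormal_fourier (T := 1)).comp _ Nat.cast_injective)
  rw [hnormG] at hbessel
  have hterm : ∀ n ∈ Finset.range M, ε ^ 2 *
      ‖∑ i ∈ s, c i * Complex.exp (2 * Real.pi * Complex.I * (n * θ i))‖ ^ 2 ≤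
      ‖inner ℂ (fourierLp (T := 1) 2 (n : ℤ)) G‖ ^ 2 := by
    intro n hn
    rw [norm_inner_symm, ← mul_pow]
    refine pow_le_pow_left₀ (by positivity) ?_ 2
    have hin : (inner ℂ G (fourierLp (T := 1) 2 (n : ℤ)) : ℂ) =
        (∑ i ∈ s, c i * Complex.exp (2 * Real.pi * Complex.I * (n * θ i))) *
        ∫ x in Metric.closedBall (0 : UnitAddCircle) ε, fourier (n : ℤ) x ∂haarAddCircle := by
      simp only [G, sum_inner, inner_smul_left, Finset.sum_mul, Complex.conj_conj]
      refine Finset.sum_congr rfl fun i _ => ?_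
      have : (inner ℂ (g i) (fourierLp (T := 1) 2 (n : ℤ)) : ℂ) =
          ∫ x in A i, fourier (n : ℤ) x ∂haarAddCircle := by
        rw [L2.inner_indicatorConstLp_one]
        exact integral_congr_ae (ae_restrict_of_ae (coeFn_fourierLp 2 (n : ℤ)))
      rw [this, integral_fourier_closedBall, mul_assoc, fourier_coe_apply]
      congr 3
      push_cast
      ring_nf
    rw [hin, norm_mul, mul_comm]
    refine mul_le_mul_of_nonneg_left ?_ (norm_nonneg _)
    have := half_measureReal_le_norm_integral_fourier (ε := ε) (n := n) ?_
    · have h0 := hball 0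
      simp only [μ] at h0
      rw [h0] at this
      linarith
    · have hnM : (n : ℝ) ≤ M := by exact_mod_cast (Finset.mem_range.1 hn).le
      have hpi := Real.pi_lt_d2
      have hnδ : (n : ℝ) * δ ≤ 1 / 4 := by nlinarith
      have h0 : (0 : ℝ) ≤ n * δ := by positivity
      rw [hε]
      nlinarith [Real.pi_pos]
  have hsum := (Finset.sum_le_sum hterm).trans hbessel
  rw [← Finset.mul_sum] at hsum
  have hεpos : 0 < ε := by positivity
  rw [show 6 / δ = 2 / ε by rw [hε]; field_simp; norm_num]
  rw [div_mul_eq_mul_div, le_div_iff₀ hεpos]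
  refine le_of_mul_le_mul_left ?_ hεpos
  nlinarith

/-- The Ramanujan sum `c_q(n)`. -/
noncomputable def ramanujanSum (q n : ℕ) : ℂ :=
  ∑ b ∈ Finset.range q with b.Coprime q, Complex.exp (2 * Real.pi * Complex.I * (b * n / q))

theorem sum_range_exp_two_pi_mul_div {d : ℕ} (hd : 0 < d) (h : ℤ) :
    ∑ b ∈ Finset.range d, Complex.exp (2 * Real.pi * Complex.I * (b * h / d)) =
      if (d : ℤ) ∣ h then (d : ℂ) else 0 := by
  have hd0 : (d : ℂ) ≠ 0 := by exact_mod_cast hd.ne'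
  have hpow : ∀ b : ℕ, Complex.exp (2 * Real.pi * Complex.I * (b * h / d)) =
      Complex.exp (2 * Real.pi * Complex.I * (h / d)) ^ b := by
    intro b
    rw [← Complex.exp_nat_mul]; congr 1; ring
  simp_rw [hpow]
  split_ifs with hdvd
  · obtain ⟨m, rfl⟩ := hdvd
    have : Complex.exp (2 * Real.pi * Complex.I * (((d * m : ℤ) : ℂ) / d)) = 1 := by
      rw [Complex.exp_eq_one_iff]
      refine ⟨m, ?_⟩
      push_cast; field_simp
    rw [this]; simp
  · have hne : Complex.exp (2 * Real.pi * Complex.I * (h / d)) ≠ 1 := by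
      rw [Ne, Complex.exp_eq_one_iff]
      rintro ⟨m, hm⟩
      apply hdvd
      refine ⟨m, ?_⟩
      have hpi : (2 * Real.pi * Complex.I : ℂ) ≠ 0 := Complex.two_pi_I_ne_zero
      have h1 : (h : ℂ) / d = m := by
        apply mul_left_cancel₀ hpi; rw [hm]; ring
      rw [div_eq_iff hd0] at h1
      have : (h : ℂ) = ((d * m : ℤ) : ℂ) := by rw [h1]; push_cast; ring
      exact_mod_cast this
    rw [geom_sum_eq hne, ← hpow]
    have : Complex.exp (2 * Real.pi * Complex.I * (d * h / d)) = 1 := by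
      rw [Complex.exp_eq_one_iff]
      refine ⟨h, ?_⟩
      field_simp
    rw [this]; simp

theorem sum_divisors_ramanujanSum {d : ℕ} (hd : 0 < d) (n : ℕ) :
    ∑ q ∈ d.divisors, ramanujanSum q n = if d ∣ n then (d : ℂ) else 0 := by
  have h1 := sum_range_exp_two_pi_mul_div hd (n : ℤ)
  simp only [Int.natCast_dvd_natCast, Int.cast_natCast] at h1
  rw [← h1]
  unfold ramanujanSum
  rw [Finset.sum_sigma']
  refine Finset.sum_bij' (fun x _ => x.2 * (d / x.1))
    (fun b _ => ⟨d / d.gcd b, b / d.gcd b⟩) ?_ ?_ ?_ ?_ ?_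
  · rintro ⟨q, b⟩ hx
    simp only [Finset.mem_sigma, Nat.mem_divisors, Finset.mem_filter, Finset.mem_range] at hx ⊢
    obtain ⟨⟨⟨e, rfl⟩, -⟩, hb, -⟩ := hx
    have hq : 0 < q := by omega
    rw [Nat.mul_div_cancel_left _ hq]
    exact Nat.mul_lt_mul_of_pos_right hb (Nat.pos_of_mul_pos_left hd)
  · intro b hb
    simp only [Finset.mem_sigma, Nat.mem_divisors, Finset.mem_filter, Finset.mem_range] at hb ⊢
    have hg : 0 < d.gcd b := Nat.gcd_pos_of_pos_left _ hd
    exact ⟨⟨Nat.div_dvd_of_dvd (Nat.gcd_dvd_left _ _), hd.ne'⟩,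
      Nat.div_lt_div_of_lt_of_dvd (Nat.gcd_dvd_left _ _) hb,
      (Nat.coprime_div_gcd_div_gcd hg).symm⟩
  · rintro ⟨q, b⟩ hx
    simp only [Finset.mem_sigma, Nat.mem_divisors, Finset.mem_filter, Finset.mem_range] at hx
    obtain ⟨⟨⟨e, rfl⟩, -⟩, hb, hcop⟩ := hx
    have hq : 0 < q := by omega
    have he : 0 < e := Nat.pos_of_mul_pos_left hd
    have hg : (q * e).gcd (b * e) = e := by
      rw [Nat.gcd_mul_right, Nat.gcd_comm, hcop, one_mul]
    simp only [Nat.mul_div_cancel_left _ hq, hg, Nat.mul_div_cancel _ he]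
  · intro b hb
    have hg : 0 < d.gcd b := Nat.gcd_pos_of_pos_left _ hd
    simp only
    rw [Nat.div_div_self (Nat.gcd_dvd_left _ _) hd.ne', Nat.div_mul_cancel (Nat.gcd_dvd_right _ _)]
  · rintro ⟨q, b⟩ hx
    simp only [Finset.mem_sigma, Nat.mem_divisors, Finset.mem_filter, Finset.mem_range] at hx
    obtain ⟨⟨⟨e, rfl⟩, -⟩, hb, hcop⟩ := hx
    have hq : 0 < q := by omega
    have he : 0 < e := Nat.pos_of_mul_pos_left hd
    have hq' : (q : ℂ) ≠ 0 := by exact_mod_cast hq.ne'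
    have he' : (e : ℂ) ≠ 0 := by exact_mod_cast he.ne'
    simp only [Nat.mul_div_cancel_left _ hq]
    congr 2
    push_cast
    field_simp

/-- Expansion of a divisor sum of level `y` in Ramanujan sums. -/
theorem sum_dvd_eq_sum_ramanujanSum (f : ℕ → ℂ) (y n : ℕ) :
    ∑ d ∈ Finset.Icc 1 y with d ∣ n, f d =
      ∑ q ∈ Finset.Icc 1 y,
        (∑ d ∈ Finset.Icc 1 y with q ∣ d, f d / d) * ramanujanSum q n := by
  have h1 : ∑ d ∈ Finset.Icc 1 y with d ∣ n, f d =
      ∑ d ∈ Finset.Icc 1 y, ∑ q ∈ Finset.Icc 1 y,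
        if q ∣ d then f d / d * ramanujanSum q n else 0 := by
    rw [Finset.sum_filter]
    refine Finset.sum_congr rfl fun d hd => ?_
    obtain ⟨hd1, hdy⟩ := Finset.mem_Icc.1 hd
    have hd0 : (d : ℂ) ≠ 0 := by exact_mod_cast (by omega : d ≠ 0)
    have hset : Finset.filter (fun q => q ∣ d) (Finset.Icc 1 y) = d.divisors := by
      ext q
      simp only [Finset.mem_filter, Finset.mem_Icc, Nat.mem_divisors]
      constructor
      · rintro ⟨_, h⟩; exact ⟨h, by omega⟩
      · rintro ⟨h, _⟩
        exact ⟨⟨Nat.pos_of_dvd_of_pos h hd1, (Nat.le_of_dvd hd1 h).trans hdy⟩, h⟩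
    rw [← Finset.sum_filter, hset, ← Finset.mul_sum, sum_divisors_ramanujanSum hd1]
    split_ifs
    · field_simp
    · simp
  rw [h1, Finset.sum_comm]
  refine Finset.sum_congr rfl fun q _ => ?_
  rw [Finset.sum_mul, Finset.sum_filter]

open ComplexConjugate in
theorem sum_range_norm_sq_exp_sum {ι : Type*} (s : Finset ι) (T : ι → ℕ) {q : ℕ} (hq : 0 < q) :
    ∑ b ∈ Finset.range q,
      ‖∑ j ∈ s, Complex.exp (2 * Real.pi * Complex.I * (b * T j / q))‖ ^ 2 =
      ∑ i ∈ s, ∑ j ∈ s, if (q : ℤ) ∣ (T i : ℤ) - T j then (q : ℝ) else 0 := by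
  apply Complex.ofReal_injective
  push_cast
  have hterm : ∀ b : ℕ,
      ((‖∑ j ∈ s, Complex.exp (2 * Real.pi * Complex.I * (b * T j / q))‖ : ℝ) : ℂ) ^ 2 =
      ∑ i ∈ s, ∑ j ∈ s,
        Complex.exp (2 * Real.pi * Complex.I * (b * ((T i - T j : ℤ) : ℂ) / q)) := by
    intro b
    rw [← Complex.mul_conj', map_sum, Finset.sum_mul_sum]
    refine Finset.sum_congr rfl fun i _ => Finset.sum_congr rfl fun j _ => ?_
    rw [← Complex.exp_conj, ← Complex.exp_add]
    congr 1
    simp only [map_mul, map_div₀, Complex.conj_ofReal, Complex.conj_I, map_natCast, map_ofNat]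
    push_cast
    ring
  simp_rw [hterm]
  rw [Finset.sum_comm]
  refine Finset.sum_congr rfl fun i _ => ?_
  rw [Finset.sum_comm]
  refine Finset.sum_congr rfl fun j _ => ?_
  rw [sum_range_exp_two_pi_mul_div hq]
  split_ifs <;> simp

/-- Mean square over an arithmetic progression `k₀ + W i` of a combination of shifted Ramanujan
sums with moduli coprime to `W`. -/
theorem sum_norm_sq_ramanujanSum_le (S : Finset ℕ) (W k₀ M J : ℕ) (T : ℕ → ℕ) (g : ℕ → ℝ) {Q : ℕ}
    (hS : ∀ q ∈ S, 0 < q ∧ q ≤ Q ∧ q.Coprime W) {δ : ℝ} (hδ : 0 < δ) (hδQ : δ * Q ^ 2 ≤ 1)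
    (hM : 4 * M * δ ≤ 1) :
    ∑ i ∈ Finset.range M,
      ‖∑ q ∈ S, (g q : ℂ) * ∑ j ∈ Finset.range J, ramanujanSum q (k₀ + W * i + T j)‖ ^ 2 ≤
      6 / δ * ∑ i ∈ Finset.range J, ∑ j ∈ Finset.range J,
        ∑ q ∈ S.filter (fun q : ℕ => (q : ℤ) ∣ (T i : ℤ) - T j), (q : ℝ) * g q ^ 2 := by
  classical
  let P : Finset ((_ : ℕ) × ℕ) := S.sigma fun q => (Finset.range q).filter fun b => b.Coprime q
  let θ : ((_ : ℕ) × ℕ) → ℝ := fun x => (W * x.2 : ℝ) / x.1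
  let c : ((_ : ℕ) × ℕ) → ℂ := fun x => g x.1 *
    Complex.exp (2 * Real.pi * Complex.I * (x.2 * k₀ / x.1)) *
    ∑ j ∈ Finset.range J, Complex.exp (2 * Real.pi * Complex.I * (x.2 * T j / x.1))
  have hsep : ∀ x ∈ P, ∀ x' ∈ P, x ≠ x' → ∀ m : ℤ, δ ≤ |θ x - θ x' - m| := by
    rintro ⟨q, b⟩ hx ⟨q', b'⟩ hx' hne m
    simp only [P, Finset.mem_sigma, Finset.mem_filter, Finset.mem_range] at hx hx'
    obtain ⟨hq, hb, hbq⟩ := hx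
    obtain ⟨hq', hb', hbq'⟩ := hx'
    obtain ⟨hq0, hqQ, hqW⟩ := hS q hq
    obtain ⟨hq0', hqQ', hqW'⟩ := hS q' hq'
    have hqr : (0 : ℝ) < q := by exact_mod_cast hq0
    have hqr' : (0 : ℝ) < q' := by exact_mod_cast hq0'
    have hθ : θ ⟨q, b⟩ - θ ⟨q', b'⟩ - m =
        ((W * (b * q' - b' * q) - m * (q * q') : ℤ) : ℝ) / (q * q') := by
      simp only [θ]; push_cast; field_simp
    have hnum : (W * (b * q' - b' * q) - m * (q * q') : ℤ) ≠ 0 := by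
      intro h0
      have hdvd : ((q * q' : ℕ) : ℤ) ∣ (W : ℤ) * (b * q' - b' * q) := by
        refine ⟨m, ?_⟩; push_cast; linarith
      have hcop : IsCoprime ((q * q' : ℕ) : ℤ) (W : ℤ) :=
        Nat.isCoprime_iff_coprime.2 (Nat.Coprime.mul_left hqW hqW')
      have hdvd2 := hcop.dvd_of_dvd_mul_left hdvd
      push_cast at hdvd2
      have h1 : (q : ℤ) ∣ b * q' := by
        have : (q : ℤ) ∣ b * q' - b' * q := (Dvd.intro _ rfl).trans hdvd2
        have h2 := dvd_add this (Dvd.intro_left (b' : ℤ) rfl : (q : ℤ) ∣ b' * q)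
        simpa using h2
      have h1' : (q' : ℤ) ∣ b' * q := by
        have : (q' : ℤ) ∣ b * q' - b' * q := (Dvd.intro_left _ rfl).trans hdvd2
        have h2 := dvd_sub (Dvd.intro_left (b : ℤ) rfl : (q' : ℤ) ∣ b * q') this
        simpa using h2
      have h3 : q ∣ q' := by
        have : q ∣ b * q' := by exact_mod_cast h1
        exact hbq.symm.dvd_of_dvd_mul_left this
      have h3' : q' ∣ q := by
        have : q' ∣ b' * q := by exact_mod_cast h1'
        exact hbq'.symm.dvd_of_dvd_mul_left this
      have hqq : q = q' := Nat.dvd_antisymm h3 h3'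
      subst hqq
      have h4 : (q : ℤ) ∣ b - b' := by
        have h5 : (q : ℤ) * q ∣ q * (b - b') := by
          have : (q : ℤ) * (b - b') = b * q - b' * q := by ring
          rwa [this]
        exact (mul_dvd_mul_iff_left (by exact_mod_cast hq0.ne')).1 h5
      have h6 : (b : ℤ) = b' := by
        have h7 : (b : ℤ) - b' = 0 := by
          apply Int.eq_zero_of_abs_lt_dvd h4
          rw [abs_lt]; constructor <;> omega
        omega
      apply hne
      have : b = b' := by exact_mod_cast h6
      rw [this]
    rw [hθ, abs_div, abs_of_pos (mul_pos hqr hqr'), le_div_iff₀ (mul_pos hqr hqr')]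
    have h1 : (1 : ℝ) ≤ |((W * (b * q' - b' * q) - m * (q * q') : ℤ) : ℝ)| := by
      rw [← Int.cast_abs]; exact_mod_cast Int.one_le_abs hnum
    refine le_trans ?_ h1
    refine le_trans ?_ hδQ
    refine mul_le_mul_of_nonneg_left ?_ hδ.le
    rw [sq]
    have e1 : (q : ℝ) ≤ Q := by exact_mod_cast hqQ
    have e2 : (q' : ℝ) ≤ Q := by exact_mod_cast hqQ'
    exact mul_le_mul e1 e2 hqr'.le (by positivity)
  have hmain := large_sieve P θ c hδ hsep M hM
  have hL : ∀ i : ℕ, ∑ q ∈ S, (g q : ℂ) * ∑ j ∈ Finset.range J, ramanujanSum q (k₀ + W * i + T j) =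
      ∑ x ∈ P, c x * Complex.exp (2 * Real.pi * Complex.I * (i * θ x)) := by
    intro i
    rw [Finset.sum_sigma]
    refine Finset.sum_congr rfl fun q _ => ?_
    unfold ramanujanSum
    rw [Finset.sum_comm, Finset.mul_sum]
    refine Finset.sum_congr rfl fun b _ => ?_
    simp only [c, θ]
    rw [Finset.mul_sum, Finset.mul_sum, Finset.sum_mul]
    refine Finset.sum_congr rfl fun j _ => ?_
    rw [mul_assoc (g q : ℂ), mul_assoc (g q : ℂ), ← Complex.exp_add, ← Complex.exp_add]
    congr 2
    push_cast
    ring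
  simp_rw [hL]
  refine hmain.trans ?_
  refine mul_le_mul_of_nonneg_left ?_ (by positivity)
  rw [Finset.sum_sigma]
  have hR : ∑ i ∈ Finset.range J, ∑ j ∈ Finset.range J,
        ∑ q ∈ S.filter (fun q : ℕ => (q : ℤ) ∣ (T i : ℤ) - T j), (q : ℝ) * g q ^ 2 =
      ∑ q ∈ S, g q ^ 2 * ∑ i ∈ Finset.range J, ∑ j ∈ Finset.range J,
        if (q : ℤ) ∣ (T i : ℤ) - T j then (q : ℝ) else 0 := by
    simp_rw [Finset.sum_filter, Finset.mul_sum]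
    rw [Finset.sum_comm (s := S)]
    refine Finset.sum_congr rfl fun i _ => ?_
    rw [Finset.sum_comm (s := S)]
    refine Finset.sum_congr rfl fun j _ => Finset.sum_congr rfl fun q _ => ?_
    split_ifs <;> ring
  rw [hR]
  refine Finset.sum_le_sum fun q hq => ?_
  rw [← sum_range_norm_sq_exp_sum _ _ (hS q hq).1, Finset.mul_sum]
  refine (Finset.sum_le_sum_of_subset_of_nonneg (Finset.filter_subset _ _)
    (fun _ _ _ => by positivity)).trans (le_of_eq ?_)
  refine Finset.sum_congr rfl fun b _ => ?_
  have he : ‖Complex.exp (2 * Real.pi * Complex.I * (b * k₀ / q))‖ = 1 := by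
    have : (2 * Real.pi * Complex.I * (b * k₀ / q) : ℂ) =
      ((2 * Real.pi * (b * k₀ / q) : ℝ) : ℂ) * Complex.I := by push_cast; ring
    rw [this, Complex.norm_exp_ofReal_mul_I]
  simp only [c, norm_mul, he, mul_one, Complex.norm_real, mul_pow, Real.norm_eq_abs, sq_abs]

/-- Abel's inequality: a sum with bounded partial sums weighted by a nonnegative antitone
sequence. -/
theorem norm_sum_range_smul_le_of_antitone (f : ℕ → ℝ) (u : ℕ → ℂ) {B : ℝ}
    (hf : Antitone f) (hf0 : ∀ i, 0 ≤ f i)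
    (hB : ∀ K, ‖∑ i ∈ Finset.range K, u i‖ ≤ B) (K : ℕ) :
    ‖∑ i ∈ Finset.range K, (f i : ℂ) * u i‖ ≤ f 0 * B := by
  have key : ∀ K, ∑ i ∈ Finset.range K, (f i : ℂ) * u i =
      f K * ∑ i ∈ Finset.range K, u i +
        ∑ i ∈ Finset.range K, ((f i - f (i + 1) : ℝ) : ℂ) * ∑ j ∈ Finset.range (i + 1), u j := by
    intro K
    induction K with
    | zero => simp
    | succ K ih =>
      rw [Finset.sum_range_succ, ih, Finset.sum_range_succ (fun i => ((f i - f (i + 1) : ℝ) : ℂ) *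
        ∑ j ∈ Finset.range (i + 1), u j), Finset.sum_range_succ u]
      push_cast
      ring
  rw [key]
  have h1 : ‖(f K : ℂ) * ∑ i ∈ Finset.range K, u i‖ ≤ f K * B := by
    rw [norm_mul, Complex.norm_real, Real.norm_of_nonneg (hf0 K)]
    exact mul_le_mul_of_nonneg_left (hB K) (hf0 K)
  have h2 : ‖∑ i ∈ Finset.range K, ((f i - f (i + 1) : ℝ) : ℂ) *
      ∑ j ∈ Finset.range (i + 1), u j‖ ≤ ∑ i ∈ Finset.range K, (f i - f (i + 1)) * B := by
    refine norm_sum_le_of_le _ fun i _ => ?_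
    have h0 : 0 ≤ f i - f (i + 1) := sub_nonneg.2 (hf (Nat.le_succ i))
    rw [norm_mul, Complex.norm_real, Real.norm_of_nonneg h0]
    exact mul_le_mul_of_nonneg_left (hB _) h0
  rw [← Finset.sum_mul, Finset.sum_range_sub'] at h2
  calc _ ≤ f K * B + (f 0 - f K) * B := (norm_add_le _ _).trans (add_le_add h1 h2)
    _ = f 0 * B := by ring

theorem DirichletCharacter.sum_range_modulus_eq_zero {N : ℕ} [NeZero N]
    {χ : DirichletCharacter ℂ N} (hχ : χ ≠ 1) : ∑ i ∈ Finset.range N, χ (i : ZMod N) = 0 := by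
  rw [← MulChar.sum_eq_zero_of_ne_one hχ]
  refine Finset.sum_bij' (fun i _ => (i : ZMod N)) (fun x _ => x.val) ?_ ?_ ?_ ?_ ?_
  · simp
  · intro x _; simpa using ZMod.val_lt x
  · intro i hi; exact ZMod.val_cast_of_lt (by simpa using hi)
  · intro x _; simp
  · simp

theorem DirichletCharacter.norm_sum_range_le {N : ℕ} [NeZero N]
    {χ : DirichletCharacter ℂ N} (hχ : χ ≠ 1) (K : ℕ) :
    ‖∑ i ∈ Finset.range K, χ (i : ZMod N)‖ ≤ N := by
  induction K using Nat.strong_induction_on with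
  | _ K ih =>
    rcases le_or_gt K N with h | h
    · calc _ ≤ ∑ i ∈ Finset.range K, (1 : ℝ) := norm_sum_le_of_le _ fun i _ => χ.norm_le_one _
        _ = K := by simp
        _ ≤ N := by exact_mod_cast h
    · obtain ⟨m, rfl⟩ := Nat.exists_eq_add_of_lt h
      have := ih (m + 1) (by have := NeZero.pos N; omega)
      rw [add_assoc, Finset.sum_range_add, sum_range_modulus_eq_zero hχ, zero_add]
      simpa using this

theorem DirichletCharacter.norm_sum_range_add_le {N : ℕ} [NeZero N]
    {χ : DirichletCharacter ℂ N} (hχ : χ ≠ 1) (n K : ℕ) :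
    ‖∑ i ∈ Finset.range K, χ ((n + i : ℕ) : ZMod N)‖ ≤ 2 * N := by
  have h := Finset.sum_range_add (fun i => χ (i : ZMod N)) n K
  have h' : ∑ i ∈ Finset.range K, χ ((n + i : ℕ) : ZMod N) =
      ∑ i ∈ Finset.range (n + K), χ (i : ZMod N) - ∑ i ∈ Finset.range n, χ (i : ZMod N) := by
    rw [h]; ring
  rw [h']
  calc _ ≤ _ := norm_sub_le _ _
    _ ≤ N + N := add_le_add (norm_sum_range_le hχ _) (norm_sum_range_le hχ _)
    _ = 2 * N := by ring

open Topology in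
/-- The partial sums of `L(1, χ)` converge with error `O(1/n)`. -/
theorem DirichletCharacter.norm_sum_div_sub_LFunction_one_le {N : ℕ} [NeZero N]
    {χ : DirichletCharacter ℂ N} (hχ : χ ≠ 1) (n : ℕ) :
    ‖∑ m ∈ Finset.range (n + 1), χ (m : ZMod N) / (m : ℂ) - LFunction χ 1‖ ≤ 2 * N / (n + 1) := by
  have hN1 : N ≠ 1 := by
    rintro rfl
    exact hχ (DirichletCharacter.level_one χ)
  have : Nontrivial (ZMod N) := ZMod.nontrivial_iff.2 hN1
  -- the truncated series, for real `s > 1`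
  have hs : ∀ s : ℝ, 1 < s →
      ‖∑ m ∈ Finset.range (n + 1), LSeries.term (fun m : ℕ => χ (m : ZMod N)) s m -
        LFunction χ s‖ ≤ 2 * N / (n + 1) := by
    intro s hs
    have hsum : LSeriesSummable (fun m : ℕ => χ (m : ZMod N)) (s : ℂ) :=
      χ.LSeriesSummable_of_one_lt_re (by simpa using hs)
    have ht : Tendsto (fun K => ∑ m ∈ Finset.range (n + 1 + K),
        LSeries.term (fun m : ℕ => χ (m : ZMod N)) s m) atTop (𝓝 (LFunction χ s)) := by
      rw [LFunction_eq_LSeries χ (by simpa using hs)]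
      have := hsum.hasSum.tendsto_sum_nat
      exact this.comp (tendsto_add_atTop_nat (n + 1) |>.congr fun _ => by ring)
    have ht2 := (tendsto_const_nhds (x := ∑ m ∈ Finset.range (n + 1),
      LSeries.term (fun m : ℕ => χ (m : ZMod N)) s m)).sub ht |>.norm
    refine le_of_tendsto ht2 (Eventually.of_forall fun K => ?_)
    rw [Finset.sum_range_add _ (n + 1) K, sub_add_cancel_left, norm_neg]
    set f : ℕ → ℝ := fun i => ((n + 1 + i : ℕ) : ℝ) ^ (-s) with hf
    have hterm : ∀ i, LSeries.term (fun m : ℕ => χ (m : ZMod N)) s (n + 1 + i) =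
        (f i : ℂ) * χ ((n + 1 + i : ℕ) : ZMod N) := by
      intro i
      rw [LSeries.term_of_ne_zero (by omega), hf]
      simp only
      rw [Complex.ofReal_cpow (by positivity), Complex.ofReal_neg, Complex.cpow_neg,
        Complex.ofReal_natCast]
      rw [div_eq_mul_inv, mul_comm]
    simp_rw [hterm]
    refine (norm_sum_range_smul_le_of_antitone f _ (B := 2 * N) ?_ ?_
      (norm_sum_range_add_le hχ (n + 1)) K).trans ?_
    · intro i j hij
      refine Real.rpow_le_rpow_of_nonpos (by positivity) ?_ (by linarith)
      exact_mod_cast (by omega : n + 1 + i ≤ n + 1 + j)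
    · intro i; positivity
    · have : f 0 ≤ ((n : ℝ) + 1)⁻¹ := by
        rw [hf]
        simp only [add_zero, Nat.cast_add, Nat.cast_one]
        rw [← Real.rpow_neg_one]
        exact Real.rpow_le_rpow_of_exponent_le (by linarith [(n.cast_nonneg : (0:ℝ) ≤ n)])
          (by linarith)
      calc f 0 * (2 * N) ≤ ((n : ℝ) + 1)⁻¹ * (2 * N) := by gcongr
        _ = _ := by ring
  have hcont : Continuous (fun s : ℝ => ∑ m ∈ Finset.range (n + 1),
      LSeries.term (fun m : ℕ => χ (m : ZMod N)) s m - LFunction χ s) := by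
    refine Continuous.sub (continuous_finsetSum _ fun m _ => ?_)
      ((differentiable_LFunction hχ).continuous.comp Complex.continuous_ofReal)
    rcases eq_or_ne m 0 with rfl | hm
    · simpa using continuous_const
    · simp_rw [LSeries.term_of_ne_zero hm]
      have hm0 : (m : ℂ) ≠ 0 := by exact_mod_cast hm
      have : Continuous fun s : ℝ => (m : ℂ) ^ (s : ℂ) :=
        Continuous.const_cpow Complex.continuous_ofReal (Or.inl hm0)
      exact continuous_const.div this fun s => by simp [Complex.cpow_eq_zero_iff, hm0]
  have hlim : Tendsto (fun s : ℝ => ‖∑ m ∈ Finset.range (n + 1),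
      LSeries.term (fun m : ℕ => χ (m : ZMod N)) s m - LFunction χ s‖) (𝓝[>] 1) (𝓝 _) :=
    (hcont.norm.tendsto 1).mono_left nhdsWithin_le_nhds
  have hfin := le_of_tendsto hlim (eventually_nhdsWithin_of_forall fun s (h : 1 < s) => hs s h)
  rw [Complex.ofReal_one] at hfin
  refine Eq.trans_le ?_ hfin
  congr 2
  refine Finset.sum_congr rfl fun m _ => ?_
  rcases eq_or_ne m 0 with rfl | hm
  · simp
  · rw [LSeries.term_of_ne_zero hm]; simp

open NumberTheorySymbols in
/-- The Jacobi symbol `d ↦ (d / A)` as a complex Dirichlet character. -/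
noncomputable def jacobiDirichletCharacter (A : ℕ) [NeZero A] : DirichletCharacter ℂ A :=
  MulChar.mk
    { toFun := fun x => ((J((x.val : ℤ) | A) : ℤ) : ℂ)
      map_one' := by
        rw [ZMod.val_one_eq_one_mod, Int.natCast_mod, ← jacobiSym.mod_left]
        simp
      map_mul' := fun x y => by
        rw [ZMod.val_mul, Int.natCast_mod, ← jacobiSym.mod_left, Nat.cast_mul, jacobiSym.mul_left]
        push_cast; rfl }
    (fun x hx => by
      have h : J((x.val : ℤ) | A) = 0 := by
        rw [jacobiSym.eq_zero_iff_not_coprime]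
        intro hc
        refine hx ?_
        rw [← ZMod.natCast_zmod_val x]
        exact (ZMod.isUnit_iff_coprime _ _).2 (by simpa only [Int.gcd_natCast_natCast] using hc)
      change ((J((x.val : ℤ) | A) : ℤ) : ℂ) = 0
      rw [h, Int.cast_zero])

open NumberTheorySymbols in
theorem jacobiDirichletCharacter_apply (A : ℕ) [NeZero A] (d : ℕ) :
    jacobiDirichletCharacter A (d : ZMod A) = ((J((d : ℤ) | A) : ℤ) : ℂ) := by
  change ((J(((d : ZMod A).val : ℤ) | A) : ℤ) : ℂ) = _
  rw [ZMod.val_natCast, Int.natCast_mod, ← jacobiSym.mod_left]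

open NumberTheorySymbols in
theorem jacobiSym_neg_one_of_mod_four_eq_three {A : ℕ} (hA : A % 4 = 3) : J(-1 | A) = -1 := by
  rw [jacobiSym.at_neg_one (Nat.odd_iff.2 (by omega)), ZMod.χ₄_nat_three_mod_four hA]

open NumberTheorySymbols in
theorem jacobiDirichletCharacter_ne_one {A : ℕ} [NeZero A] (hA : A % 4 = 3) :
    jacobiDirichletCharacter A ≠ 1 := by
  intro h
  have h1 := jacobiDirichletCharacter_apply A (A - 1)
  have h2 : J(((A - 1 : ℕ) : ℤ) | A) = -1 := by
    rw [← jacobiSym_neg_one_of_mod_four_eq_three hA]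
    apply jacobiSym.mod_left'
    rw [Nat.cast_sub (by omega)]
    simp
  rw [h, h2] at h1
  have hu : IsUnit ((A - 1 : ℕ) : ZMod A) := by
    rw [Nat.cast_sub (by omega)]; simp
  rw [MulChar.one_apply hu] at h1
  norm_num at h1

open NumberTheorySymbols in
theorem exists_abs_sum_jacobiSym_div_sub_le {A : ℕ} (hA : A % 4 = 3) :
    ∃ L : ℝ, L ≠ 0 ∧ ∀ n : ℕ,
      |∑ m ∈ Finset.Icc 1 n, (J((m : ℤ) | A) : ℝ) / m - L| ≤ 2 * A / (n + 1) := by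
  have : NeZero A := ⟨by omega⟩
  have hχ := jacobiDirichletCharacter_ne_one hA
  set l := (jacobiDirichletCharacter A).LFunction 1 with hl
  have hl0 : l ≠ 0 := DirichletCharacter.LFunction_apply_one_ne_zero hχ
  have hb : ∀ n : ℕ, ‖((∑ m ∈ Finset.Icc 1 n, (J((m : ℤ) | A) : ℝ) / m : ℝ) : ℂ) - l‖ ≤
      2 * A / (n + 1) := by
    intro n
    refine Eq.trans_le ?_ (DirichletCharacter.norm_sum_div_sub_LFunction_one_le hχ n)
    congr 2
    rw [Finset.range_eq_Ico, Finset.sum_eq_sum_Ico_succ_bot (by omega)]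
    push_cast
    simp only [div_zero, zero_add]
    refine Finset.sum_congr ?_ fun m _ => ?_
    · ext; simp
    · rw [jacobiDirichletCharacter_apply]
  have htend : Tendsto (fun n : ℕ => (2 * A / (n + 1) : ℝ)) atTop (nhds 0) := by
    have := (tendsto_one_div_add_atTop_nhds_zero_nat (𝕜 := ℝ)).const_mul (2 * (A : ℝ))
    simpa [mul_div_assoc, div_eq_mul_inv] using this
  have him : l.im = 0 := by
    have h : ∀ n : ℕ, |l.im| ≤ 2 * A / (n + 1) := fun n => by
      have := (Complex.abs_im_le_norm _).trans (hb n)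
      rwa [Complex.sub_im, Complex.ofReal_im, zero_sub, abs_neg] at this
    exact abs_nonpos_iff.1 (ge_of_tendsto' htend h)
  refine ⟨l.re, fun h => hl0 (Complex.ext h him), fun n => ?_⟩
  have := (Complex.abs_re_le_norm _).trans (hb n)
  rwa [Complex.sub_re, Complex.ofReal_re] at this

open NumberTheorySymbols in
/-- The Jacobi symbol `(d / A)`, restricted to integers `d` without prime factors `≤ w`. -/
noncomputable def siftedJacobi (A w d : ℕ) : ℝ :=
  if d.Coprime (primorial w) then (J((d : ℤ) | A) : ℝ) else 0

theorem siftedJacobi_mul (A w m n : ℕ) :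
    siftedJacobi A w (m * n) = siftedJacobi A w m * siftedJacobi A w n := by
  unfold siftedJacobi
  have h := Nat.coprime_mul_iff_left (k := primorial w) (m := m) (n := n)
  by_cases hm : m.Coprime (primorial w)
  · by_cases hn : n.Coprime (primorial w)
    · rw [if_pos hm, if_pos hn, if_pos (h.2 ⟨hm, hn⟩), Nat.cast_mul, jacobiSym.mul_left,
        Int.cast_mul]
    · rw [if_neg hn, if_neg fun h' => hn (h.1 h').2, mul_zero]
  · rw [if_neg hm, if_neg fun h' => hm (h.1 h').1, zero_mul]

theorem abs_siftedJacobi_le_one (A w m : ℕ) : |siftedJacobi A w m| ≤ 1 := by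
  unfold siftedJacobi
  split_ifs
  · rcases jacobiSym.trichotomy (m : ℤ) A with h | h | h <;> simp [h]
  · simp

theorem siftedJacobi_one (A w : ℕ) : siftedJacobi A w 1 = 1 := by simp [siftedJacobi]

theorem siftedJacobi_zero_level (A m : ℕ) : siftedJacobi A 0 m = (jacobiSym (m : ℤ) A : ℝ) := by
  simp [siftedJacobi]

theorem primorial_succ_of_prime {w : ℕ} (h : (w + 1).Prime) :
    primorial (w + 1) = (w + 1) * primorial w := by
  unfold primorial
  rw [Finset.range_add_one, Finset.filter_insert, if_pos h, Finset.prod_insert (by simp)]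

theorem primorial_succ_of_not_prime {w : ℕ} (h : ¬ (w + 1).Prime) :
    primorial (w + 1) = primorial w := by
  unfold primorial
  rw [Finset.range_add_one, Finset.filter_insert, if_neg h]

/-- Sum over the multiples of `q` of a completely multiplicative function. -/
theorem sum_multiples_div_eq (f : ℕ → ℝ) (hf : ∀ m n, f (m * n) = f m * f n) (y : ℕ) {q : ℕ}
    (hq : 0 < q) :
    ∑ d ∈ Finset.Icc 1 y with q ∣ d, f d / d =
      f q / q * ∑ m ∈ Finset.Icc 1 (y / q), f m / m := by
  rw [Finset.mul_sum]
  refine (Finset.sum_bij (fun m _ => q * m) ?_ ?_ ?_ ?_).symm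
  · intro m hm
    simp only [Finset.mem_Icc, Finset.mem_filter] at hm ⊢
    refine ⟨⟨Nat.mul_pos hq hm.1, ?_⟩, dvd_mul_right _ _⟩
    rw [mul_comm]; exact (Nat.le_div_iff_mul_le hq).1 hm.2
  · intro m _ n _ h; exact Nat.eq_of_mul_eq_mul_left hq h
  · intro d hd
    simp only [Finset.mem_Icc, Finset.mem_filter] at hd
    obtain ⟨⟨h1, h2⟩, m, rfl⟩ := hd
    refine ⟨m, ?_, rfl⟩
    simp only [Finset.mem_Icc]
    refine ⟨Nat.pos_of_ne_zero (by rintro rfl; simp at h1),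
      (Nat.le_div_iff_mul_le hq).2 (by rwa [mul_comm])⟩
  · intro m _
    rw [hf]; push_cast; rw [div_mul_div_comm]

theorem siftedJacobi_succ_of_prime {A w : ℕ} (h : (w + 1).Prime) (m : ℕ) :
    siftedJacobi A (w + 1) m = siftedJacobi A w m - if (w + 1) ∣ m then siftedJacobi A w m else 0 := by
  unfold siftedJacobi
  have hc : m.Coprime (primorial (w + 1)) ↔ ¬ (w + 1) ∣ m ∧ m.Coprime (primorial w) := by
    rw [primorial_succ_of_prime h, Nat.coprime_mul_iff_right, Nat.coprime_comm,
      Nat.Prime.coprime_iff_not_dvd h]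
  by_cases h2 : m.Coprime (primorial w)
  · by_cases h1 : (w + 1) ∣ m
    · rw [if_neg fun h' => (hc.1 h').1 h1, if_pos h1, sub_self]
    · rw [if_pos (hc.2 ⟨h1, h2⟩), if_pos h2, if_neg h1, sub_zero]
  · rw [if_neg fun h' => h2 (hc.1 h').2, if_neg h2, ite_self, sub_self]

/-- The logarithmic means of the sifted Jacobi symbol. -/
theorem exists_abs_sum_siftedJacobi_div_sub_le {A : ℕ} (hA : A % 4 = 3) :
    ∃ L : ℝ, 0 < L ∧ ∀ w : ℕ, ∃ l : ℝ, L ≤ 2 ^ w * |l| ∧ ∀ n : ℕ,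
      |∑ m ∈ Finset.Icc 1 n, siftedJacobi A w m / m - l| ≤ 2 * A * 2 ^ w / (n + 1) := by
  obtain ⟨L, hL0, hL⟩ := exists_abs_sum_jacobiSym_div_sub_le hA
  refine ⟨|L|, abs_pos.2 hL0, fun w => ?_⟩
  induction w with
  | zero => exact ⟨L, by simp, fun n => by simpa [siftedJacobi_zero_level] using hL n⟩
  | succ w ih =>
    obtain ⟨l, hl, hbound⟩ := ih
    by_cases hp : (w + 1).Prime
    · set p := w + 1 with hpdef
      have hp0 : (0 : ℝ) < p := by exact_mod_cast hp.pos
      have hp2 : (2 : ℝ) ≤ p := by exact_mod_cast hp.two_le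
      set c : ℝ := siftedJacobi A w p / p with hc
      have hc1 : |c| ≤ 1 / p := by
        rw [hc, abs_div, abs_of_pos hp0]
        gcongr
        exact abs_siftedJacobi_le_one A w p
      have hc2 : |c| ≤ 1 / 2 := hc1.trans (by gcongr)
      refine ⟨l * (1 - c), ?_, fun n => ?_⟩
      · rw [abs_mul, pow_succ]
        have : 1 / 2 ≤ |1 - c| := by
          have := abs_sub_abs_le_abs_sub 1 c
          rw [abs_one] at this
          linarith
        have h0 : 0 ≤ 2 ^ w * |l| := by positivity
        nlinarith
      · have hsum : ∑ m ∈ Finset.Icc 1 n, siftedJacobi A p m / m =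
            ∑ m ∈ Finset.Icc 1 n, siftedJacobi A w m / m -
              c * ∑ m ∈ Finset.Icc 1 (n / p), siftedJacobi A w m / m := by
          rw [hc, ← sum_multiples_div_eq _ (siftedJacobi_mul A w) n hp.pos, Finset.sum_filter,
            ← Finset.sum_sub_distrib]
          refine Finset.sum_congr rfl fun m _ => ?_
          rw [siftedJacobi_succ_of_prime hp, sub_div]
          split_ifs <;> simp
        rw [hsum]
        have hdiv : ((n : ℝ) + 1) ≤ p * ((n / p : ℕ) + 1) := by
          have := Nat.lt_mul_div_succ n hp.pos
          exact_mod_cast this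
        have e1 := hbound n
        have e2 := hbound (n / p)
        have hn0 : (0 : ℝ) < n + 1 := by positivity
        have e3 : |c| * (2 * A * 2 ^ w / ((n / p : ℕ) + 1)) ≤ 2 * A * 2 ^ w / (n + 1) := by
          calc |c| * (2 * A * 2 ^ w / ((n / p : ℕ) + 1))
              ≤ 1 / p * (2 * A * 2 ^ w / ((n / p : ℕ) + 1)) := by gcongr
            _ = 2 * A * 2 ^ w / (p * ((n / p : ℕ) + 1)) := by
              field_simp
            _ ≤ _ := by gcongr
        set X := ∑ m ∈ Finset.Icc 1 n, siftedJacobi A w m / m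
        set Y := ∑ m ∈ Finset.Icc 1 (n / p), siftedJacobi A w m / m
        calc |X - c * Y - l * (1 - c)| = |(X - l) - c * (Y - l)| := by ring_nf
          _ ≤ |X - l| + |c| * |Y - l| := (abs_sub _ _).trans (by rw [abs_mul])
          _ ≤ 2 * A * 2 ^ w / (n + 1) + 2 * A * 2 ^ w / (n + 1) :=
            add_le_add e1 ((mul_le_mul_of_nonneg_left e2 (abs_nonneg c)).trans e3)
          _ = 2 * A * 2 ^ (w + 1) / (n + 1) := by ring
    · refine ⟨l, hl.trans ?_, fun n => ?_⟩
      · rw [pow_succ]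
        have h0 : 0 ≤ 2 ^ w * |l| := by positivity
        nlinarith
      · have : ∀ m, siftedJacobi A (w + 1) m = siftedJacobi A w m := fun m => by
          unfold siftedJacobi; rw [primorial_succ_of_not_prime hp]
        simp_rw [this]
        refine (hbound n).trans ?_
        gcongr
        · norm_num
        · omega

/-- The sum of reciprocals of the divisors of `n` free of small primes. -/
noncomputable def roughDivisorSum (w n : ℕ) : ℝ :=
  ∑ q ∈ n.divisors with q.Coprime (primorial w), (1 / q : ℝ)

theorem roughDivisorSum_le_exp {w : ℕ} (hw : 2 ≤ w) {n : ℕ} (hn : n ≠ 0) :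
    roughDivisorSum w n ≤ Real.exp (Real.log n / (w * Real.log w)) := by
  have hlogw : 0 < Real.log w := Real.log_pos (by exact_mod_cast hw)
  have hw0 : (0 : ℝ) < w := by positivity
  induction n using induction_on_primes with
  | zero => exact absurd rfl hn
  | one => simp [roughDivisorSum, Finset.filter_singleton]
  | prime_mul p m hp ih =>
    have hm : m ≠ 0 := by rintro rfl; simp at hn
    have hp0 : (0 : ℝ) < p := by exact_mod_cast hp.pos
    have hm0 : (0 : ℝ) < m := by exact_mod_cast Nat.pos_of_ne_zero hm
    have hnn : 0 ≤ roughDivisorSum w m := Finset.sum_nonneg fun _ _ => by positivity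
    have hdiv : (p * m).divisors ⊆ m.divisors ∪ m.divisors.image (p * ·) := by
      intro d hd
      rw [Nat.mem_divisors] at hd
      rw [Finset.mem_union, Finset.mem_image]
      by_cases h : p ∣ d
      · right
        obtain ⟨e, rfl⟩ := h
        exact ⟨e, Nat.mem_divisors.2 ⟨Nat.dvd_of_mul_dvd_mul_left hp.pos hd.1, hm⟩, rfl⟩
      · left
        exact Nat.mem_divisors.2
          ⟨((Nat.Prime.coprime_iff_not_dvd hp).2 h).symm.dvd_of_dvd_mul_left hd.1, hm⟩
    have hsplit : roughDivisorSum w (p * m) ≤ roughDivisorSum w m +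
        ∑ q ∈ m.divisors, if (p * q).Coprime (primorial w) then (1 / (p * q : ℕ) : ℝ) else 0 := by
      unfold roughDivisorSum
      rw [Finset.sum_filter, Finset.sum_filter]
      refine (Finset.sum_le_sum_of_subset_of_nonneg hdiv fun _ _ _ => by positivity).trans ?_
      rw [← Finset.sum_image (s := m.divisors) (g := (p * ·))
        (f := fun q : ℕ => if q.Coprime (primorial w) then (1 / q : ℝ) else 0)
        fun x _ y _ h => Nat.eq_of_mul_eq_mul_left hp.pos h, ← Finset.sum_union_inter]
      exact le_add_of_nonneg_right (Finset.sum_nonneg fun _ _ => by positivity)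
    by_cases hpw : p ≤ w
    · have hz : ∀ q ∈ m.divisors, (if (p * q).Coprime (primorial w) then
          (1 / (p * q : ℕ) : ℝ) else 0) = 0 := by
        intro q _
        refine if_neg fun h => ?_
        have := (Nat.coprime_mul_iff_left.1 h).1
        exact (Nat.Prime.coprime_iff_not_dvd hp).1 this (hp.dvd_primorial_iff.2 hpw)
      rw [Finset.sum_eq_zero hz, add_zero] at hsplit
      refine hsplit.trans ((ih hm).trans ?_)
      gcongr
      exact Nat.le_mul_of_pos_left m hp.pos
    · have hle : ∑ q ∈ m.divisors, (if (p * q).Coprime (primorial w) then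
          (1 / (p * q : ℕ) : ℝ) else 0) ≤ 1 / p * roughDivisorSum w m := by
        unfold roughDivisorSum
        rw [Finset.sum_filter, Finset.mul_sum]
        refine Finset.sum_le_sum fun q _ => ?_
        by_cases h : (p * q).Coprime (primorial w)
        · rw [if_pos h, if_pos (Nat.coprime_mul_iff_left.1 h).2]
          push_cast
          rw [one_div_mul_one_div]
        · rw [if_neg h]; positivity
      have hpw' : (w : ℝ) ≤ p := by exact_mod_cast (not_le.1 hpw).le
      have h1 : 1 / (p : ℝ) ≤ Real.log p / (w * Real.log w) := by
        rw [div_le_div_iff₀ hp0 (by positivity), one_mul]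
        have : Real.log w ≤ Real.log p := Real.log_le_log hw0 hpw'
        nlinarith
      have h2 : 1 + 1 / (p : ℝ) ≤ Real.exp (Real.log p / (w * Real.log w)) := by
        have := Real.add_one_le_exp (Real.log p / (w * Real.log w))
        linarith
      push_cast
      rw [Real.log_mul hp0.ne' hm0.ne', add_div, Real.exp_add]
      calc roughDivisorSum w (p * m) ≤ (1 + 1 / p) * roughDivisorSum w m := by linarith
        _ ≤ _ := mul_le_mul h2 (ih hm) hnn (Real.exp_pos _).le

/-- An integer at most `4 ^ (w D)` has little mass on its nontrivial divisors free of primes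
up to `w`. -/
theorem sum_rough_divisors_le {w : ℕ} (hw : 2 ≤ w) {n D : ℕ} (hn : n ≠ 0)
    (hnD : n ≤ 4 ^ (w * D)) :
    ∑ q ∈ n.divisors with q.Coprime (primorial w) ∧ 1 < q, (1 / q : ℝ) ≤
      Real.exp (D * Real.log 4 / Real.log w) - 1 := by
  have hlogw : 0 < Real.log w := Real.log_pos (by exact_mod_cast hw)
  have hw0 : (0 : ℝ) < w := by positivity
  have h1 : 1 + ∑ q ∈ n.divisors with q.Coprime (primorial w) ∧ 1 < q, (1 / q : ℝ) ≤
      roughDivisorSum w n := by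
    unfold roughDivisorSum
    have hins : 1 + ∑ q ∈ n.divisors with q.Coprime (primorial w) ∧ 1 < q, (1 / q : ℝ) =
        ∑ q ∈ insert 1 (n.divisors.filter fun q => q.Coprime (primorial w) ∧ 1 < q),
          (1 / q : ℝ) := by
      rw [Finset.sum_insert (by simp)]; simp
    rw [hins]
    refine Finset.sum_le_sum_of_subset_of_nonneg ?_ fun _ _ _ => by positivity
    intro q hq
    simp only [Finset.mem_insert, Finset.mem_filter] at hq ⊢
    rcases hq with rfl | ⟨h, h', -⟩
    · simp [hn]
    · exact ⟨h, h'⟩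
  have h2 : Real.log n / (w * Real.log w) ≤ D * Real.log 4 / Real.log w := by
    rw [div_le_div_iff₀ (by positivity) hlogw]
    have h3 : Real.log n ≤ w * D * Real.log 4 := by
      have := Real.log_le_log (by exact_mod_cast Nat.pos_of_ne_zero hn)
        (show (n : ℝ) ≤ (4 : ℝ) ^ (w * D) by exact_mod_cast hnD)
      rwa [Real.log_pow, Nat.cast_mul] at this
    nlinarith
  have h4 := (roughDivisorSum_le_exp hw hn).trans (Real.exp_le_exp.2 h2)
  linarith

theorem tendsto_exp_div_log_sub_one (D : ℕ) :
    Tendsto (fun w : ℕ => Real.exp (D * Real.log 4 / Real.log w) - 1) atTop (nhds 0) := by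
  have h : Tendsto (fun w : ℕ => D * Real.log 4 / Real.log w) atTop (nhds 0) :=
    tendsto_const_nhds.div_atTop (Real.tendsto_log_atTop.comp tendsto_natCast_atTop_atTop)
  simpa using (Real.continuous_exp.tendsto 0 |>.comp h).sub_const 1

theorem exists_pow_eq_of_not_modEq_one {p r : ℕ} [Fact p.Prime] (hr : r.Prime)
    (h : ¬ p ≡ 1 [MOD r]) (c : ZMod p) : ∃ t : ZMod p, t ^ r = c := by
  rcases eq_or_ne c 0 with rfl | hc
  · exact ⟨0, zero_pow hr.ne_zero⟩
  · have hp := Fact.out (p := p.Prime)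
    have hcop : (Nat.card (ZMod p)ˣ).Coprime r := by
      rw [Nat.card_eq_fintype_card, ZMod.card_units, Nat.coprime_comm,
        Nat.Prime.coprime_iff_not_dvd hr]
      intro hd
      exact h ((Nat.modEq_iff_dvd' hp.one_le).2 hd).symm
    refine ⟨((powCoprime hcop).symm (Units.mk0 c hc) : (ZMod p)ˣ), ?_⟩
    have := (powCoprime hcop).apply_symm_apply (Units.mk0 c hc)
    rw [powCoprime_apply] at this
    rw [← Units.val_pow_eq_pow_val, this, Units.val_mk0]

/-- Simultaneous choice of a residue class of `t` making `κ + t ^ r` locally solvable. -/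
theorem exists_add_pow_coprime_primorial {A r w : ℕ} (hA : Squarefree A) (hr : r.Prime)
    (hAr : ∀ p : ℕ, p.Prime → p ∣ A → ¬ p ≡ 1 [MOD r]) (hw : A ≤ w) (hw2 : 2 ≤ w) (κ : ℕ) :
    ∃ t < primorial w, (κ + t ^ r).Coprime (primorial w) ∧ κ + t ^ r ≡ 1 [MOD A] := by
  have hloc : ∀ p : ℕ, ∃ t : ℕ, p.Prime →
      ((κ + t ^ r : ℕ) : ZMod p) ≠ 0 ∧ (p ∣ A → ((κ + t ^ r : ℕ) : ZMod p) = 1) := by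
    intro p
    by_cases hp : p.Prime
    swap
    · exact ⟨0, fun h => absurd h hp⟩
    have : Fact p.Prime := ⟨hp⟩
    by_cases hpA : p ∣ A
    · obtain ⟨t, ht⟩ := exists_pow_eq_of_not_modEq_one hr (hAr p hp hpA) (1 - (κ : ZMod p))
      refine ⟨t.val, fun _ => ?_⟩
      have : ((κ + t.val ^ r : ℕ) : ZMod p) = 1 := by
        push_cast
        rw [ZMod.natCast_zmod_val, ht]; ring
      rw [this]
      exact ⟨one_ne_zero, fun _ => rfl⟩
    · by_cases h0 : (κ : ZMod p) = 0
      · exact ⟨1, fun _ => ⟨by simp [h0], fun h => absurd h hpA⟩⟩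
      · exact ⟨0, fun _ => ⟨by simpa [hr.ne_zero] using h0, fun h => absurd h hpA⟩⟩
  choose c hc using hloc
  set s : Finset ℕ := (Finset.range (w + 1)).filter Nat.Prime with hs
  have hsp : ∀ p ∈ s, p.Prime := fun p hp => (Finset.mem_filter.1 hp).2
  obtain ⟨t, ht⟩ := Nat.chineseRemainderOfFinset c id s (fun p hp => (hsp p hp).ne_zero)
    (fun p hp q hq hpq => (Nat.coprime_primes (hsp p hp) (hsp q hq)).2 hpq)
  have hcast : ∀ p ∈ s, ((κ + (t % primorial w) ^ r : ℕ) : ZMod p) =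
      ((κ + c p ^ r : ℕ) : ZMod p) := by
    intro p hp
    have h1 : t % primorial w ≡ c p [MOD p] := by
      refine Nat.ModEq.trans ?_ (ht p hp)
      refine (Nat.mod_modEq t (primorial w)).of_dvd ((hsp p hp).dvd_primorial_iff.2 ?_)
      have := (Finset.mem_filter.1 hp).1
      rw [Finset.mem_range] at this; omega
    exact (ZMod.natCast_eq_natCast_iff _ _ _).2 ((h1.pow r).add_left κ)
  have hcop : (κ + (t % primorial w) ^ r).Coprime (primorial w) := by
    refine Nat.Coprime.prod_right fun p hp => ?_
    rw [Nat.coprime_comm, Nat.Prime.coprime_iff_not_dvd (hsp p hp), ← ZMod.natCast_eq_zero_iff,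
      hcast p hp]
    exact (hc p (hsp p hp)).1
  refine ⟨t % primorial w, Nat.mod_lt _ (primorial_pos w), hcop, ?_⟩
  have hpos : 1 ≤ κ + (t % primorial w) ^ r := by
    rw [Nat.one_le_iff_ne_zero]
    intro h0
    rw [h0, Nat.coprime_zero_left] at hcop
    have := Nat.prime_two.dvd_primorial_iff.2 hw2
    rw [hcop] at this
    norm_num at this
  refine ((Nat.modEq_iff_dvd' hpos).2 ?_).symm
  rw [← Nat.prod_primeFactors_of_squarefree hA]
  refine Finset.prod_primes_dvd _ (fun p hp => (Nat.prime_of_mem_primeFactors hp).prime) ?_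
  intro p hp
  have hpp := Nat.prime_of_mem_primeFactors hp
  have hpA := Nat.dvd_of_mem_primeFactors hp
  have hps : p ∈ s := by
    have := Nat.le_of_dvd (Nat.pos_of_ne_zero hA.ne_zero) hpA
    exact Finset.mem_filter.2 ⟨Finset.mem_range.2 (by omega), hpp⟩
  refine (Nat.modEq_iff_dvd' hpos).1 (Nat.ModEq.symm ?_)
  rw [← ZMod.natCast_eq_natCast_iff, hcast p hps, (hc p hpp).2 hpA, Nat.cast_one]

/-- The divisor sum `∑_{d ∣ n} (d / A)`. -/
def jacobiDivisorSum (A n : ℕ) : ℤ := ∑ d ∈ n.divisors, jacobiSym d A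

/-- If the divisor sum of the Jacobi symbol vanishes, the sum over the divisors up to about
`√n` is controlled by the number of divisors very close to `√n`. -/
theorem two_mul_abs_sum_siftedJacobi_le {A w n y : ℕ} (hn : 0 < n)
    (hW : n.Coprime (primorial w)) (hχ : jacobiSym n A = 1) (hR : jacobiDivisorSum A n = 0)
    (hy : n < (y + 1) ^ 2) :
    2 * |∑ d ∈ Finset.Icc 1 y with d ∣ n, siftedJacobi A w d| ≤
      ((Finset.Icc 1 y).filter fun d => d ∣ n ∧ n ≤ d * y).card := by
  have hfd : ∀ d ∈ n.divisors, siftedJacobi A w d = (jacobiSym d A : ℝ) := by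
    intro d hd
    exact if_pos (Nat.Coprime.coprime_dvd_left (Nat.dvd_of_mem_divisors hd) hW)
  have hset : ((Finset.Icc 1 y).filter fun d => d ∣ n) = n.divisors.filter fun d => d ≤ y := by
    ext d
    simp only [Finset.mem_filter, Finset.mem_Icc, Nat.mem_divisors]
    constructor
    · rintro ⟨⟨_, h⟩, h'⟩; exact ⟨⟨h', hn.ne'⟩, h⟩
    · rintro ⟨⟨h', _⟩, h⟩; exact ⟨⟨Nat.pos_of_dvd_of_pos h' hn, h⟩, h'⟩
  have hset2 : ((Finset.Icc 1 y).filter fun d => d ∣ n ∧ n ≤ d * y) =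
      (n.divisors.filter fun d => d ≤ y).filter fun d => n ≤ d * y := by
    rw [← hset, Finset.filter_filter]
  rw [hset, hset2]
  have hsymm : ∀ d ∈ n.divisors, siftedJacobi A w (n / d) = siftedJacobi A w d := by
    intro d hd
    rw [hfd _ (Nat.mem_divisors.2
      ⟨Nat.div_dvd_of_dvd (Nat.dvd_of_mem_divisors hd), hn.ne'⟩), hfd d hd]
    have h1 : jacobiSym (d : ℤ) A * jacobiSym ((n / d : ℕ) : ℤ) A = 1 := by
      rw [← jacobiSym.mul_left, ← Nat.cast_mul, Nat.mul_div_cancel' (Nat.dvd_of_mem_divisors hd),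
        hχ]
    rcases jacobiSym.trichotomy (d : ℤ) A with h | h | h <;> rw [h] at h1 ⊢
    · simp at h1
    · rw [one_mul] at h1; rw [h1]
    · rw [show jacobiSym ((n / d : ℕ) : ℤ) A = -1 by linarith]
  have hsum0 : ∑ d ∈ n.divisors, siftedJacobi A w d = 0 := by
    rw [Finset.sum_congr rfl hfd]
    exact_mod_cast hR
  have hsplit := Finset.sum_filter_add_sum_filter_not n.divisors (fun d => d ≤ y)
    (siftedJacobi A w)
  have hsplit2 := Finset.sum_filter_add_sum_filter_not (n.divisors.filter fun d => d ≤ y)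
    (fun d => n ≤ d * y) (siftedJacobi A w)
  have hflip : ∑ d ∈ n.divisors with ¬ d ≤ y, siftedJacobi A w d =
      ∑ d ∈ (n.divisors.filter fun d => d ≤ y) with ¬ n ≤ d * y, siftedJacobi A w d := by
    refine Finset.sum_bij' (fun d _ => n / d) (fun d _ => n / d) ?_ ?_ ?_ ?_ ?_
    · intro d hd
      simp only [Finset.mem_filter, Nat.mem_divisors] at hd ⊢
      obtain ⟨⟨⟨e, rfl⟩, h0⟩, hd2⟩ := hd
      have hd0 : 0 < d := by omega
      have he0 : 0 < e := Nat.pos_of_ne_zero (by rintro rfl; simp at h0)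
      rw [Nat.mul_div_cancel_left e hd0]
      refine ⟨⟨⟨dvd_mul_left _ _, h0⟩, ?_⟩, ?_⟩
      · by_contra hc
        nlinarith [Nat.mul_le_mul (show y + 1 ≤ d by omega) (show y + 1 ≤ e by omega)]
      · rw [not_le, mul_comm d e]
        exact Nat.mul_lt_mul_of_pos_left (by omega) he0
    · intro d hd
      simp only [Finset.mem_filter, Nat.mem_divisors] at hd ⊢
      obtain ⟨⟨⟨⟨e, rfl⟩, h0⟩, -⟩, hd2⟩ := hd
      have hd0 : 0 < d := Nat.pos_of_ne_zero (by rintro rfl; simp at h0)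
      rw [Nat.mul_div_cancel_left e hd0]
      exact ⟨⟨dvd_mul_left _ _, h0⟩, fun h => hd2 (Nat.mul_le_mul_left d h)⟩
    · intro d hd
      exact Nat.div_div_self (Nat.dvd_of_mem_divisors (Finset.mem_filter.1 hd).1) hn.ne'
    · intro d hd
      exact Nat.div_div_self (Nat.dvd_of_mem_divisors
        (Finset.mem_filter.1 (Finset.mem_filter.1 hd).1).1) hn.ne'
    · intro d hd
      exact (hsymm d (Finset.mem_filter.1 hd).1).symm
  set B := ∑ d ∈ n.divisors with d ≤ y, siftedJacobi A w d
  have h2 : 2 * B = ∑ d ∈ (n.divisors.filter fun d => d ≤ y) with n ≤ d * y,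
      siftedJacobi A w d := by linarith
  have h3 : 2 * |B| = |2 * B| := by rw [abs_mul, abs_two]
  rw [h3, h2]
  refine (Finset.abs_sum_le_sum_abs _ _).trans ?_
  refine (Finset.sum_le_sum fun d _ => abs_siftedJacobi_le_one A w d).trans ?_
  simp

/-- Terms of an arithmetic progression divisible by `d`. -/
theorem card_filter_dvd_add_mul_le {W d : ℕ} (hd : d.Coprime W) (c M : ℕ) :
    ((Finset.range M).filter fun i => d ∣ c + W * i).card ≤ M / d + 1 := by
  rw [← Finset.card_range (M / d + 1)]
  refine Finset.card_le_card_of_injOn (fun i => i / d) ?_ ?_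
  · intro i hi
    simp only [Finset.mem_coe, Finset.mem_filter, Finset.mem_range] at hi
    simp only [Finset.coe_range, Set.mem_Iio]
    exact Nat.lt_succ_of_le (Nat.div_le_div_right hi.1.le)
  · intro i hi j hj hij
    simp only [Finset.mem_coe, Finset.mem_filter, Finset.mem_range] at hi hj
    simp only at hij
    have h1 : W * i ≡ W * j [MOD d] := by
      refine Nat.ModEq.add_left_cancel' c ?_
      exact ((Nat.modEq_zero_iff_dvd.2 hi.2).trans (Nat.modEq_zero_iff_dvd.2 hj.2).symm)
    have h2 : i % d = j % d := Nat.ModEq.cancel_left_of_coprime hd h1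
    rw [← Nat.div_add_mod i d, ← Nat.div_add_mod j d, hij, h2]

theorem sum_range_sum_range_le {J : ℕ} (F : ℕ → ℕ → ℝ) {a b : ℝ} (ha : 0 ≤ a)
    (hd : ∀ i < J, F i i ≤ b) (ho : ∀ i < J, ∀ j < J, i ≠ j → F i j ≤ a) :
    ∑ i ∈ Finset.range J, ∑ j ∈ Finset.range J, F i j ≤ J ^ 2 * a + J * b := by
  have h : ∀ i ∈ Finset.range J, ∑ j ∈ Finset.range J, F i j ≤ J * a + b := by
    intro i hi
    rw [← Finset.add_sum_erase _ _ hi]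
    have h1 := hd i (Finset.mem_range.1 hi)
    have h2 : ∑ j ∈ (Finset.range J).erase i, F i j ≤ ∑ j ∈ (Finset.range J).erase i, a :=
      Finset.sum_le_sum fun j hj => ho i (Finset.mem_range.1 hi) j
        (Finset.mem_range.1 (Finset.mem_of_mem_erase hj)) (Finset.ne_of_mem_erase hj).symm
    have h3 : ∑ j ∈ (Finset.range J).erase i, a ≤ J * a := by
      rw [Finset.sum_const, nsmul_eq_mul]
      gcongr
      simpa using Finset.card_erase_le (s := Finset.range J) (a := i)
    linarith
  refine (Finset.sum_le_sum h).trans_eq ?_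
  simp; ring

/-- Number of near-`√n` divisors, averaged over an arithmetic progression. -/
theorem sum_card_edge_le {W M k₀ T x y : ℕ} (hx : 0 < x) (hxk : x ≤ k₀)
    (hcop : ∀ i < M, (k₀ + W * i + T).Coprime W) :
    (∑ i ∈ Finset.range M, ((Finset.Icc 1 y).filter fun d =>
      d ∣ k₀ + W * i + T ∧ k₀ + W * i + T ≤ d * y).card : ℝ) ≤
      ((Finset.Icc 1 y).filter fun d => x ≤ d * y).card * (M * y / x + 1) := by
  have hx0 : (0 : ℝ) < x := by exact_mod_cast hx
  have h1 : ∀ i ∈ Finset.range M, ((Finset.Icc 1 y).filter fun d =>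
      d ∣ k₀ + W * i + T ∧ k₀ + W * i + T ≤ d * y).card ≤
      ∑ d ∈ (Finset.Icc 1 y).filter (fun d => x ≤ d * y),
        if d ∣ k₀ + W * i + T then 1 else 0 := by
    intro i _
    rw [← Finset.card_filter, Finset.filter_filter]
    refine Finset.card_le_card fun d hd => ?_
    simp only [Finset.mem_filter] at hd ⊢
    exact ⟨hd.1, le_trans (by omega) hd.2.2, hd.2.1⟩
  have h2 : ∑ i ∈ Finset.range M, ((Finset.Icc 1 y).filter fun d =>
      d ∣ k₀ + W * i + T ∧ k₀ + W * i + T ≤ d * y).card ≤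
      ∑ d ∈ (Finset.Icc 1 y).filter (fun d => x ≤ d * y),
        ((Finset.range M).filter fun i => d ∣ k₀ + W * i + T).card := by
    refine (Finset.sum_le_sum h1).trans_eq ?_
    rw [Finset.sum_comm]
    simp_rw [Finset.card_filter]
  have h3 : ∀ d ∈ (Finset.Icc 1 y).filter (fun d => x ≤ d * y),
      (((Finset.range M).filter fun i => d ∣ k₀ + W * i + T).card : ℝ) ≤ M * y / x + 1 := by
    intro d hd
    simp only [Finset.mem_filter, Finset.mem_Icc] at hd
    by_cases hdW : d.Coprime W
    · have h4 := card_filter_dvd_add_mul_le hdW (k₀ + T) M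
      have h5 : ((Finset.range M).filter fun i => d ∣ k₀ + W * i + T) =
          (Finset.range M).filter fun i => d ∣ k₀ + T + W * i := by
        simp_rw [add_right_comm]
      rw [h5]
      have hd0 : (0 : ℝ) < d := by exact_mod_cast hd.1.1
      have h6 : ((M / d : ℕ) : ℝ) ≤ M * y / x := by
        refine Nat.cast_div_le.trans ?_
        rw [div_le_div_iff₀ hd0 hx0]
        have : (x : ℝ) ≤ d * y := by exact_mod_cast hd.2
        have hM : (0 : ℝ) ≤ M := M.cast_nonneg
        nlinarith
      calc _ ≤ (((M / d + 1 : ℕ)) : ℝ) := by exact_mod_cast h4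
        _ ≤ _ := by push_cast; linarith
    · have : ((Finset.range M).filter fun i => d ∣ k₀ + W * i + T) = ∅ := by
        refine Finset.filter_eq_empty_iff.2 fun i hi hdvd => hdW ?_
        exact Nat.Coprime.coprime_dvd_left hdvd (hcop i (Finset.mem_range.1 hi))
      rw [this]
      simp only [Finset.card_empty, Nat.cast_zero]
      positivity
  calc _ ≤ ((∑ d ∈ (Finset.Icc 1 y).filter (fun d => x ≤ d * y),
        ((Finset.range M).filter fun i => d ∣ k₀ + W * i + T).card : ℕ) : ℝ) := by
        exact_mod_cast h2
    _ ≤ _ := by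
        push_cast
        refine (Finset.sum_le_sum h3).trans_eq ?_
        rw [Finset.sum_const, nsmul_eq_mul]

theorem ramanujanSum_one (n : ℕ) : ramanujanSum 1 n = 1 := by
  simp [ramanujanSum]

/-- A variance bound: a real linear combination of Ramanujan sums over the progression
`k₀ + W i + T j` is small on average over `i`. -/
theorem sum_norm_sq_ramanujanSum_le_of_bounds (S : Finset ℕ) (W k₀ M J : ℕ) (T : ℕ → ℕ) (g : ℕ → ℝ)
    {Q : ℕ} {δ b a h : ℝ} (hS : ∀ q ∈ S, 0 < q ∧ q ≤ Q ∧ q.Coprime W) (hδ : 0 < δ)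
    (hδQ : δ * Q ^ 2 ≤ 1) (hM : 4 * M * δ ≤ 1) (ha : 0 ≤ a)
    (hg : ∀ q ∈ S, |g q| ≤ b / q) (hdiag : ∑ q ∈ S, (1 / q : ℝ) ≤ h)
    (hoff : ∀ i < J, ∀ j < J, i ≠ j →
      ∑ q ∈ S.filter (fun q : ℕ => (q : ℤ) ∣ (T i : ℤ) - T j), (1 / q : ℝ) ≤ a) :
    ∑ i ∈ Finset.range M, ‖∑ q ∈ S, (g q : ℂ) *
      ∑ j ∈ Finset.range J, ramanujanSum q (k₀ + W * i + T j)‖ ^ 2 ≤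
      6 / δ * (b ^ 2 * (J ^ 2 * a + J * h)) := by
  refine (sum_norm_sq_ramanujanSum_le S W k₀ M J T g hS hδ hδQ hM).trans ?_
  have hterm : ∀ q ∈ S, (q : ℝ) * g q ^ 2 ≤ b ^ 2 * (1 / q) := by
    intro q hq
    have hq0 : (0 : ℝ) < q := by exact_mod_cast (hS q hq).1
    have h1 : g q ^ 2 ≤ (b / q) ^ 2 := by
      rw [← sq_abs]
      exact pow_le_pow_left₀ (abs_nonneg _) (hg q hq) 2
    calc (q : ℝ) * g q ^ 2 ≤ q * (b / q) ^ 2 := by gcongr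
      _ = b ^ 2 * (1 / q) := by field_simp
  have hfil : ∀ i j, ∑ q ∈ S.filter (fun q : ℕ => (q : ℤ) ∣ (T i : ℤ) - T j), (q : ℝ) * g q ^ 2 ≤
      b ^ 2 * ∑ q ∈ S.filter (fun q : ℕ => (q : ℤ) ∣ (T i : ℤ) - T j), (1 / q : ℝ) := by
    intro i j
    rw [Finset.mul_sum]
    exact Finset.sum_le_sum fun q hq => hterm q (Finset.mem_of_mem_filter q hq)
  refine mul_le_mul_of_nonneg_left ?_ (by positivity)
  calc _ ≤ ∑ i ∈ Finset.range J, ∑ j ∈ Finset.range J, b ^ 2 *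
        ∑ q ∈ S.filter (fun q : ℕ => (q : ℤ) ∣ (T i : ℤ) - T j), (1 / q : ℝ) :=
        Finset.sum_le_sum fun i _ => Finset.sum_le_sum fun j _ => hfil i j
    _ = b ^ 2 * ∑ i ∈ Finset.range J, ∑ j ∈ Finset.range J,
        ∑ q ∈ S.filter (fun q : ℕ => (q : ℤ) ∣ (T i : ℤ) - T j), (1 / q : ℝ) := by
        simp_rw [Finset.mul_sum]
    _ ≤ _ := by
        refine mul_le_mul_of_nonneg_left ?_ (sq_nonneg b)
        refine sum_range_sum_range_le _ ha (fun i _ => ?_) hoff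
        simpa using hdiag

theorem one_le_of_le_add_add {c u v d : ℝ} (hc : 0 < c) (hu : 0 ≤ u) (hv : 0 ≤ v) (hd : 0 ≤ d)
    (h : c ≤ d + 2 * u + 2 * v) :
    1 ≤ 64 / c ^ 2 * u ^ 2 + 64 / c ^ 2 * v ^ 2 + 2 / c * d := by
  have h0 : 0 ≤ 64 / c ^ 2 * u ^ 2 := by positivity
  have h1 : 0 ≤ 64 / c ^ 2 * v ^ 2 := by positivity
  have h2 : 0 ≤ 2 / c * d := by positivity
  by_cases c1 : c ≤ 8 * u
  · have : 1 ≤ 64 / c ^ 2 * u ^ 2 := by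
      rw [div_mul_eq_mul_div, one_le_div (by positivity)]
      nlinarith
    linarith
  by_cases c2 : c ≤ 8 * v
  · have : 1 ≤ 64 / c ^ 2 * v ^ 2 := by
      rw [div_mul_eq_mul_div, one_le_div (by positivity)]
      nlinarith
    linarith
  · have : 1 ≤ 2 / c * d := by
      rw [div_mul_eq_mul_div, one_le_div (by positivity)]
      linarith
    linarith

set_option maxHeartbeats 1000000 in
/-- The main sieve inequality: an upper bound for the number of `i < M` such that the divisor sums
vanish at all the integers `k₀ + W i + T j`. -/
theorem card_jacobiDivisorSum_eq_zero_le {A w k₀ M J x y Q Z : ℕ} (T : ℕ → ℕ) {l η U h : ℝ}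
    (hl : 0 < l) (hη : 0 ≤ η) (hJ : 0 < J) (hM : 0 < M) (hQ : 0 < Q) (hQy : Q ≤ y)
    (hx : 0 < x) (hxk : x ≤ k₀)
    (hQM : Q ^ 2 ≤ 4 * M) (hMy : 4 * M ≤ y ^ 2)
    (hg1 : l ≤ 2 * |∑ m ∈ Finset.Icc 1 y, siftedJacobi A w m / m|)
    (hgs : ∀ q, 0 < q → q ≤ Q → |∑ m ∈ Finset.Icc 1 (y / q), siftedJacobi A w m / m| ≤ 2 * l)
    (hgl : ∀ n, |∑ m ∈ Finset.Icc 1 n, siftedJacobi A w m / m| ≤ U)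
    (hh : ∑ q ∈ Finset.Icc 1 y, (1 / q : ℝ) ≤ h)
    (hT : ∀ i < J, ∀ j < J, i ≠ j → T i ≠ T j)
    (hZ : ∀ i < J, T i ≤ Z)
    (hoff : ∀ n, n ≠ 0 → n ≤ Z →
      ∑ q ∈ n.divisors with q.Coprime (primorial w) ∧ 1 < q, (1 / q : ℝ) ≤ η)
    (hcop : ∀ i < M, ∀ j < J, (k₀ + primorial w * i + T j).Coprime (primorial w))
    (hχ : ∀ i < M, ∀ j < J, jacobiSym (k₀ + primorial w * i + T j : ℕ) A = 1)
    (hy : ∀ i < M, ∀ j < J, k₀ + primorial w * i + T j < (y + 1) ^ 2) :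
    (((Finset.range M).filter fun i =>
      ∀ j < J, jacobiDivisorSum A (k₀ + primorial w * i + T j) = 0).card : ℝ) ≤
      6144 * M * (η + h / J) + 384 * (y ^ 2 * U ^ 2 / l ^ 2) * (Z / Q + h / J) +
        2 / l * (((Finset.Icc 1 y).filter fun d => x ≤ d * y).card * (M * y / x + 1)) := by
  set W := primorial w with hW
  set n : ℕ → ℕ → ℕ := fun i j => k₀ + W * i + T j with hn
  set f := siftedJacobi A w with hf
  set P : ℕ → ℝ := fun z => ∑ m ∈ Finset.Icc 1 z, f m / m with hP
  set g : ℕ → ℝ := fun q => f q / q * P (y / q) with hg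
  have hJ0 : (0 : ℝ) < J := by exact_mod_cast hJ
  have hM0 : (0 : ℝ) < M := by exact_mod_cast hM
  have hQ0 : (0 : ℝ) < Q := by exact_mod_cast hQ
  have hy0 : (0 : ℝ) < y := by exact_mod_cast lt_of_lt_of_le hQ hQy
  have hU0 : 0 ≤ U := (abs_nonneg _).trans (hgl 0)
  have hB : ∀ m, ((∑ d ∈ Finset.Icc 1 y with d ∣ m, f d : ℝ) : ℂ) =
      ∑ q ∈ Finset.Icc 1 y, (g q : ℂ) * ramanujanSum q m := by
    intro m
    have := sum_dvd_eq_sum_ramanujanSum (fun d => (f d : ℂ)) y m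
    push_cast
    rw [this]
    refine Finset.sum_congr rfl fun q hq => ?_
    congr 1
    rw [hg]
    simp only
    rw [← sum_multiples_div_eq f (siftedJacobi_mul A w) y (Finset.mem_Icc.1 hq).1]
    push_cast
    rfl
  have hfz : ∀ q, ¬ q.Coprime W → g q = 0 := by
    intro q hq
    simp [hg, hf, siftedJacobi, ← hW, hq]
  have hgabs : ∀ q, ∀ b, 0 < q → |P (y / q)| ≤ b → |g q| ≤ b / q := by
    intro q b hq hb
    have hq0 : (0 : ℝ) < q := by exact_mod_cast hq
    rw [hg]
    simp only
    rw [abs_mul, abs_div, abs_of_pos hq0, div_mul_eq_mul_div]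
    gcongr
    calc |f q| * |P (y / q)| ≤ 1 * b :=
          mul_le_mul (abs_siftedJacobi_le_one A w q) hb (abs_nonneg _) zero_le_one
      _ = b := one_mul b
  set S₁ := (Finset.Icc 2 Q).filter fun q => q.Coprime W with hS₁
  set S₂ := (Finset.Icc (Q + 1) y).filter fun q => q.Coprime W with hS₂
  set E₁ : ℕ → ℂ := fun i => ∑ q ∈ S₁, (g q : ℂ) * ∑ j ∈ Finset.range J,
    ramanujanSum q (k₀ + W * i + T j) with hE₁
  set E₂ : ℕ → ℂ := fun i => ∑ q ∈ S₂, (g q : ℂ) * ∑ j ∈ Finset.range J,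
    ramanujanSum q (k₀ + W * i + T j) with hE₂
  have hdecomp : ∀ i, ((∑ j ∈ Finset.range J, ∑ d ∈ Finset.Icc 1 y with d ∣ n i j, f d : ℝ) : ℂ) =
      g 1 * J + E₁ i + E₂ i := by
    intro i
    have h1 : ((∑ j ∈ Finset.range J, ∑ d ∈ Finset.Icc 1 y with d ∣ n i j, f d : ℝ) : ℂ) =
        ∑ q ∈ Finset.Icc 1 y, (g q : ℂ) * ∑ j ∈ Finset.range J, ramanujanSum q (n i j) := by
      rw [Complex.ofReal_sum, Finset.sum_congr rfl fun j _ => hB (n i j), Finset.sum_comm]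
      simp_rw [Finset.mul_sum]
    have hsub : ∀ I : Finset ℕ, ∑ q ∈ I, (g q : ℂ) * ∑ j ∈ Finset.range J,
        ramanujanSum q (n i j) = ∑ q ∈ I.filter (fun q => q.Coprime W), (g q : ℂ) *
          ∑ j ∈ Finset.range J, ramanujanSum q (n i j) := by
      intro I
      rw [Finset.sum_filter]
      refine Finset.sum_congr rfl fun q _ => ?_
      split_ifs with hq
      · rfl
      · rw [hfz q hq]; simp
    have hunion : Finset.Icc 1 y = insert 1 (Finset.Icc 2 Q ∪ Finset.Icc (Q + 1) y) := by
      ext q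
      simp only [Finset.mem_Icc, Finset.mem_insert, Finset.mem_union]
      omega
    rw [h1, hunion, Finset.sum_insert (by simp; omega), Finset.sum_union, hsub (Finset.Icc 2 Q),
      hsub (Finset.Icc (Q + 1) y), add_assoc]
    · congr 1
      simp [ramanujanSum_one]
    · rw [Finset.disjoint_left]
      intro q
      simp only [Finset.mem_Icc]
      omega
  have hdiv : ∀ i < J, ∀ j < J, i ≠ j → ∀ q : ℕ, (q : ℤ) ∣ (T i : ℤ) - T j →
      q ∈ ((T i : ℤ) - T j).natAbs.divisors := by
    intro i hi j hj hij q hq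
    rw [Nat.mem_divisors]
    refine ⟨Int.natCast_dvd.1 hq, ?_⟩
    have := hT i hi j hj hij
    omega
  have hE₁sum : ∑ i ∈ Finset.range M, ‖E₁ i‖ ^ 2 ≤
      6 / (1 / (4 * M)) * ((2 * l) ^ 2 * (J ^ 2 * η + J * h)) := by
    refine sum_norm_sq_ramanujanSum_le_of_bounds S₁ W k₀ M J T g (Q := Q) ?_ (by positivity) ?_ ?_
      hη ?_ ?_ ?_
    · intro q hq
      rw [hS₁, Finset.mem_filter, Finset.mem_Icc] at hq
      exact ⟨by omega, hq.1.2, hq.2⟩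
    · rw [div_mul_eq_mul_div, one_mul, div_le_one (by positivity)]
      exact_mod_cast hQM
    · rw [mul_one_div, div_self (by positivity)]
    · intro q hq
      rw [hS₁, Finset.mem_filter, Finset.mem_Icc] at hq
      exact hgabs q _ (by omega) (hgs q (by omega) hq.1.2)
    · refine le_trans (Finset.sum_le_sum_of_subset_of_nonneg ?_ fun _ _ _ => by positivity) hh
      intro q hq
      rw [hS₁, Finset.mem_filter, Finset.mem_Icc] at hq
      rw [Finset.mem_Icc]; omega
    · intro i hi j hj hij
      refine le_trans (Finset.sum_le_sum_of_subset_of_nonneg ?_ fun _ _ _ => by positivity)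
        (hoff ((T i : ℤ) - T j).natAbs ?_ ?_)
      · intro q hq
        rw [hS₁, Finset.mem_filter, Finset.mem_filter, Finset.mem_Icc] at hq
        rw [Finset.mem_filter]
        exact ⟨hdiv i hi j hj hij q hq.2, hq.1.2, by omega⟩
      · have := hT i hi j hj hij
        omega
      · have := hZ i hi
        have := hZ j hj
        omega
  have hE₂sum : ∑ i ∈ Finset.range M, ‖E₂ i‖ ^ 2 ≤
      6 / (1 / (y : ℝ) ^ 2) * (U ^ 2 * (J ^ 2 * (Z / Q) + J * h)) := by
    refine sum_norm_sq_ramanujanSum_le_of_bounds S₂ W k₀ M J T g (Q := y) ?_ (by positivity) ?_ ?_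
      (by positivity) ?_ ?_ ?_
    · intro q hq
      rw [hS₂, Finset.mem_filter, Finset.mem_Icc] at hq
      exact ⟨by omega, hq.1.2, hq.2⟩
    · rw [div_mul_eq_mul_div, one_mul, div_self (by positivity)]
    · rw [mul_one_div, div_le_one (by positivity)]
      exact_mod_cast hMy
    · intro q hq
      rw [hS₂, Finset.mem_filter, Finset.mem_Icc] at hq
      exact hgabs q _ (by omega) (hgl _)
    · refine le_trans (Finset.sum_le_sum_of_subset_of_nonneg ?_ fun _ _ _ => by positivity) hh
      intro q hq
      rw [hS₂, Finset.mem_filter, Finset.mem_Icc] at hq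
      rw [Finset.mem_Icc]; omega
    · intro i hi j hj hij
      set m := ((T i : ℤ) - T j).natAbs with hm
      have hmZ : m ≤ Z := by
        have := hZ i hi
        have := hZ j hj
        omega
      calc ∑ q ∈ S₂.filter (fun q : ℕ => (q : ℤ) ∣ (T i : ℤ) - T j), (1 / q : ℝ)
          ≤ ∑ q ∈ S₂.filter (fun q : ℕ => (q : ℤ) ∣ (T i : ℤ) - T j), (1 / Q : ℝ) := by
            refine Finset.sum_le_sum fun q hq => ?_
            rw [hS₂, Finset.mem_filter, Finset.mem_filter, Finset.mem_Icc] at hq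
            gcongr
            omega
        _ = (S₂.filter (fun q : ℕ => (q : ℤ) ∣ (T i : ℤ) - T j)).card * (1 / Q : ℝ) := by
            rw [Finset.sum_const, nsmul_eq_mul]
        _ ≤ Z * (1 / Q : ℝ) := by
            gcongr
            refine le_trans ?_ ((Nat.card_divisors_le_self m).trans hmZ)
            refine Finset.card_le_card fun q hq => ?_
            exact hdiv i hi j hj hij q (Finset.mem_filter.1 hq).2
        _ = Z / Q := by ring
  set Ed : ℕ → ℕ → ℝ := fun i j => (((Finset.Icc 1 y).filter fun d =>
    d ∣ k₀ + W * i + T j ∧ k₀ + W * i + T j ≤ d * y).card : ℝ) with hEd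
  have hEdnn : ∀ i j, 0 ≤ Ed i j := fun i j => Nat.cast_nonneg _
  have hEdsum : ∑ i ∈ Finset.range M, ∑ j ∈ Finset.range J, Ed i j ≤
      J * (((Finset.Icc 1 y).filter fun d => x ≤ d * y).card * (M * y / x + 1)) := by
    rw [Finset.sum_comm]
    refine (Finset.sum_le_sum fun j hj => sum_card_edge_le hx hxk
      fun i hi => hcop i hi j (Finset.mem_range.1 hj)).trans_eq ?_
    rw [Finset.sum_const, Finset.card_range, nsmul_eq_mul]
  -- on the bad set one of the three error terms is large
  have hbad : ∀ i ∈ (Finset.range M).filter fun i => ∀ j < J, jacobiDivisorSum A (n i j) = 0,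
      1 ≤ 64 / (l * J) ^ 2 * ‖E₁ i‖ ^ 2 + 64 / (l * J) ^ 2 * ‖E₂ i‖ ^ 2 +
        2 / (l * J) * ∑ j ∈ Finset.range J, Ed i j := by
    intro i hi
    rw [Finset.mem_filter, Finset.mem_range] at hi
    have h1 : 2 * |∑ j ∈ Finset.range J, ∑ d ∈ Finset.Icc 1 y with d ∣ n i j, f d| ≤
        ∑ j ∈ Finset.range J, Ed i j := by
      calc _ ≤ 2 * ∑ j ∈ Finset.range J, |∑ d ∈ Finset.Icc 1 y with d ∣ n i j, f d| := by
            gcongr; exact Finset.abs_sum_le_sum_abs _ _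
        _ = ∑ j ∈ Finset.range J, 2 * |∑ d ∈ Finset.Icc 1 y with d ∣ n i j, f d| :=
            Finset.mul_sum _ _ _
        _ ≤ _ := by
            refine Finset.sum_le_sum fun j hj => ?_
            rw [Finset.mem_range] at hj
            refine two_mul_abs_sum_siftedJacobi_le ?_ (hcop i hi.1 j hj) (hχ i hi.1 j hj)
              (hi.2 j hj) (hy i hi.1 j hj)
            change 0 < k₀ + W * i + T j
            omega
    have h2 : |g 1| * J ≤ |∑ j ∈ Finset.range J, ∑ d ∈ Finset.Icc 1 y with d ∣ n i j, f d| +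
        ‖E₁ i‖ + ‖E₂ i‖ := by
      have h3 : (g 1 : ℂ) * J = ((∑ j ∈ Finset.range J,
          ∑ d ∈ Finset.Icc 1 y with d ∣ n i j, f d : ℝ) : ℂ) - E₁ i - E₂ i := by
        rw [hdecomp]; ring
      have h4 : ‖(g 1 : ℂ) * J‖ = |g 1| * J := by
        rw [norm_mul, Complex.norm_real, Complex.norm_natCast, Real.norm_eq_abs]
      rw [← h4, h3, ← Real.norm_eq_abs, ← Complex.norm_real]
      exact (norm_sub_le _ _).trans (by gcongr; exact norm_sub_le _ _)
    have h5 : l ≤ 2 * |g 1| := by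
      have : g 1 = P y := by simp [hg, hf, siftedJacobi_one]
      rw [this]; exact hg1
    have hlJ : 0 < l * J := by positivity
    have h6 : l * J ≤ ∑ j ∈ Finset.range J, Ed i j + 2 * ‖E₁ i‖ + 2 * ‖E₂ i‖ := by
      have : l * J ≤ 2 * |g 1| * J := by gcongr
      linarith
    have hEd0 : 0 ≤ ∑ j ∈ Finset.range J, Ed i j := Finset.sum_nonneg fun _ _ => hEdnn _ _
    exact one_le_of_le_add_add hlJ (norm_nonneg _) (norm_nonneg _) hEd0 h6
  clear_value Ed E₁ E₂
  have hcount : (((Finset.range M).filter fun i =>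
      ∀ j < J, jacobiDivisorSum A (n i j) = 0).card : ℝ) ≤
      64 / (l * J) ^ 2 * ∑ i ∈ Finset.range M, ‖E₁ i‖ ^ 2 +
      64 / (l * J) ^ 2 * ∑ i ∈ Finset.range M, ‖E₂ i‖ ^ 2 +
      2 / (l * J) * ∑ i ∈ Finset.range M, ∑ j ∈ Finset.range J, Ed i j := by
    rw [Finset.card_eq_sum_ones, Nat.cast_sum, Nat.cast_one, Finset.mul_sum, Finset.mul_sum,
      Finset.mul_sum, ← Finset.sum_add_distrib, ← Finset.sum_add_distrib]
    refine (Finset.sum_le_sum hbad).trans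
      (Finset.sum_le_sum_of_subset_of_nonneg (Finset.filter_subset _ _) fun i _ _ => ?_)
    have := Finset.sum_nonneg fun j (_ : j ∈ Finset.range J) => hEdnn i j
    positivity
  refine hcount.trans ?_
  have r1 : 64 / (l * J) ^ 2 * (6 / (1 / (4 * M)) * ((2 * l) ^ 2 * (J ^ 2 * η + J * h))) =
      6144 * M * (η + h / J) := by field_simp; ring
  have r2 : 64 / (l * J) ^ 2 * (6 / (1 / (y : ℝ) ^ 2) * (U ^ 2 * (J ^ 2 * (Z / Q) + J * h))) =
      384 * (y ^ 2 * U ^ 2 / l ^ 2) * (Z / Q + h / J) := by field_simp; ring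
  have r3 : 2 / (l * J) * (J * (((Finset.Icc 1 y).filter fun d => x ≤ d * y).card *
      (M * y / x + 1))) =
      2 / l * (((Finset.Icc 1 y).filter fun d => x ≤ d * y).card * (M * y / x + 1)) := by
    field_simp
  rw [← r1, ← r2, ← r3]
  gcongr

theorem card_filter_le_mul_le {x y : ℕ} {s : ℝ} (hy : 0 < y) (hs : 0 ≤ s)
    (h : (y : ℝ) ^ 2 ≤ x + s) :
    (((Finset.Icc 1 y).filter fun d => x ≤ d * y).card : ℝ) ≤ s / y + 1 := by
  have hy0 : (0 : ℝ) < y := by exact_mod_cast hy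
  have hsub : ((Finset.Icc 1 y).filter fun d => x ≤ d * y) ⊆ Finset.Icc ⌈(x : ℝ) / y⌉₊ y := by
    intro d hd
    rw [Finset.mem_filter, Finset.mem_Icc] at hd
    rw [Finset.mem_Icc]
    refine ⟨Nat.ceil_le.2 ?_, hd.1.2⟩
    rw [div_le_iff₀ hy0]
    exact_mod_cast hd.2
  refine (Nat.cast_le.2 (Finset.card_le_card hsub)).trans ?_
  rw [Nat.card_Icc]
  rcases le_or_gt ⌈(x : ℝ) / y⌉₊ (y + 1) with hc | hc
  · rw [Nat.cast_sub hc]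
    have h1 := Nat.le_ceil ((x : ℝ) / y)
    have h2 : (y : ℝ) ≤ x / y + s / y := by
      rw [← add_div, le_div_iff₀ hy0]
      nlinarith
    push_cast
    linarith
  · rw [Nat.sub_eq_zero_of_le hc.le]
    simp only [Nat.cast_zero]
    positivity

/-- Real arithmetic behind the choice of parameters in the sieve. -/
theorem sieve_error_le {v p b y x l L A η D : ℝ} (hv : 4 ≤ v) (hp : 1 ≤ p) (hb : 1 ≤ b)
    (hbv : b ^ 2 = v) (hL : 0 < L) (hl : L ≤ b * l)
    (hx : p ^ 2 * v ^ 39 ≤ x) (hy : p * v ^ 19 ≤ y) (hyx : y ^ 2 ≤ 3 * x)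
    (hyv : y ^ 2 ≤ 4 * (p ^ 2 * v ^ 41)) (hD : D ≤ 2 * (p ^ 2 * v ^ 35) / y + 1) :
    6144 * (p ^ 2 * v ^ 34) * (η + v ^ 2 / v ^ 16) +
      384 * (y ^ 2 * (4 * A * b) ^ 2 / l ^ 2) * (p / (p * v ^ 14) + v ^ 2 / v ^ 16) +
      2 / l * (D * (p ^ 2 * v ^ 34 * y / x + 1)) ≤
    p ^ 2 * v ^ 34 * (6144 * η + (6144 + 49152 * A ^ 2 / L ^ 2 + 16 / L) / v) := by
  have hv0 : 0 < v := by linarith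
  have hp0 : 0 < p := by linarith
  have hb0 : 0 < b := by linarith
  have hl0 : 0 < l := by
    by_contra hc
    nlinarith
  have hx0 : 0 < x := lt_of_lt_of_le (by positivity) hx
  have hy0 : 0 < y := lt_of_lt_of_le (by positivity) hy
  have hv1 : 1 ≤ v := by linarith
  have t1 : v ^ 2 / v ^ 16 ≤ 1 / v := by
    rw [div_le_div_iff₀ (by positivity) hv0, one_mul, ← pow_succ]
    exact pow_le_pow_right₀ hv1 (by norm_num)
  have e1 : 6144 * (p ^ 2 * v ^ 34) * (η + v ^ 2 / v ^ 16) ≤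
      p ^ 2 * v ^ 34 * (6144 * η + 6144 / v) := by
    have : p ^ 2 * v ^ 34 * (6144 * η + 6144 / v) = 6144 * (p ^ 2 * v ^ 34) * (η + 1 / v) := by
      ring
    rw [this]
    gcongr
  have hll : L ^ 2 ≤ v * l ^ 2 := by
    rw [← hbv, ← mul_pow]
    gcongr
  have e2 : 384 * (y ^ 2 * (4 * A * b) ^ 2 / l ^ 2) * (p / (p * v ^ 14) + v ^ 2 / v ^ 16) ≤
      p ^ 2 * v ^ 34 * ((49152 * A ^ 2 / L ^ 2) / v) := by
    have s1 : p / (p * v ^ 14) + v ^ 2 / v ^ 16 = 2 / v ^ 14 := by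
      field_simp; ring
    have s2 : y ^ 2 * (4 * A * b) ^ 2 / l ^ 2 ≤ 64 * (p ^ 2 * v ^ 43) * A ^ 2 / L ^ 2 := by
      have s3 : 1 / l ^ 2 ≤ v / L ^ 2 := by
        rw [div_le_div_iff₀ (by positivity) (by positivity)]; linarith
      calc y ^ 2 * (4 * A * b) ^ 2 / l ^ 2 = y ^ 2 * (16 * A ^ 2 * v) * (1 / l ^ 2) := by
            rw [← hbv]; ring
        _ ≤ 4 * (p ^ 2 * v ^ 41) * (16 * A ^ 2 * v) * (v / L ^ 2) := by gcongr
        _ = _ := by ring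
    rw [s1]
    calc 384 * (y ^ 2 * (4 * A * b) ^ 2 / l ^ 2) * (2 / v ^ 14)
        ≤ 384 * (64 * (p ^ 2 * v ^ 43) * A ^ 2 / L ^ 2) * (2 / v ^ 14) := by gcongr
      _ = p ^ 2 * v ^ 34 * (49152 * A ^ 2 / L ^ 2) * (1 / v ^ 5) := by
        field_simp; ring
      _ ≤ p ^ 2 * v ^ 34 * (49152 * A ^ 2 / L ^ 2) * (1 / v) := by
        have : v ≤ v ^ 5 := le_self_pow₀ hv1 (by norm_num)
        gcongr
      _ = _ := by ring
  have hpow : ∀ {m n : ℕ}, m ≤ n → v ^ m ≤ v ^ n := fun h => pow_le_pow_right₀ hv1 h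
  have e3 : 2 / l * (D * (p ^ 2 * v ^ 34 * y / x + 1)) ≤ p ^ 2 * v ^ 34 * ((16 / L) / v) := by
    have s0 : 1 / l ≤ v / L := by
      rw [div_le_div_iff₀ hl0 hL, one_mul]
      nlinarith
    have a1 : p ^ 2 * v ^ 35 / x ≤ 1 / v ^ 2 := by
      rw [div_le_div_iff₀ hx0 (by positivity)]
      calc p ^ 2 * v ^ 35 * v ^ 2 = p ^ 2 * v ^ 37 := by ring
        _ ≤ p ^ 2 * v ^ 39 := by gcongr; norm_num
        _ ≤ 1 * x := by linarith
    have a2 : p ^ 2 * v ^ 35 / y ≤ p ^ 2 * v ^ 34 * (1 / v ^ 2) := by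
      rw [mul_one_div, div_le_div_iff₀ hy0 (by positivity)]
      have : v ^ 3 ≤ y := by
        calc v ^ 3 ≤ 1 * v ^ 19 := by rw [one_mul]; exact hpow (by norm_num)
          _ ≤ p * v ^ 19 := by gcongr
          _ ≤ y := hy
      calc p ^ 2 * v ^ 35 * v ^ 2 = p ^ 2 * v ^ 34 * v ^ 3 := by ring
        _ ≤ _ := by gcongr
    have a3 : y / x ≤ 3 / v ^ 2 := by
      rw [div_le_div_iff₀ hx0 (by positivity)]
      have : v ^ 2 ≤ y := by
        calc v ^ 2 ≤ 1 * v ^ 19 := by rw [one_mul]; exact hpow (by norm_num)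
          _ ≤ p * v ^ 19 := by gcongr
          _ ≤ y := hy
      nlinarith
    have a4 : 1 ≤ p ^ 2 * v ^ 34 * (1 / v ^ 2) := by
      rw [mul_one_div, one_le_div (by positivity)]
      calc v ^ 2 = 1 ^ 2 * v ^ 2 := by ring
        _ ≤ p ^ 2 * v ^ 34 := by gcongr; norm_num
    have hprod : D * (p ^ 2 * v ^ 34 * y / x + 1) ≤ 8 * (p ^ 2 * v ^ 34 * (1 / v ^ 2)) := by
      calc D * (p ^ 2 * v ^ 34 * y / x + 1)
          ≤ (2 * (p ^ 2 * v ^ 35) / y + 1) * (p ^ 2 * v ^ 34 * y / x + 1) := by gcongr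
        _ = 2 * (p ^ 2 * v ^ 34) * (p ^ 2 * v ^ 35 / x) + 2 * (p ^ 2 * v ^ 35 / y) +
            p ^ 2 * v ^ 34 * (y / x) + 1 := by field_simp; ring
        _ ≤ 2 * (p ^ 2 * v ^ 34) * (1 / v ^ 2) + 2 * (p ^ 2 * v ^ 34 * (1 / v ^ 2)) +
            p ^ 2 * v ^ 34 * (3 / v ^ 2) + p ^ 2 * v ^ 34 * (1 / v ^ 2) := by gcongr
        _ = _ := by ring
    calc 2 / l * (D * (p ^ 2 * v ^ 34 * y / x + 1))
        ≤ 2 / l * (8 * (p ^ 2 * v ^ 34 * (1 / v ^ 2))) := by gcongr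
      _ = 1 / l * (16 * (p ^ 2 * v ^ 34 * (1 / v ^ 2))) := by ring
      _ ≤ v / L * (16 * (p ^ 2 * v ^ 34 * (1 / v ^ 2))) := by gcongr
      _ = _ := by field_simp
  calc _ ≤ _ := add_le_add (add_le_add e1 e2) e3
    _ = _ := by ring

theorem jacobiSym_eq_one_of_modEq_one {A n : ℕ} (h : n ≡ 1 [MOD A]) : jacobiSym n A = 1 := by
  rw [← jacobiSym.one_left A]
  apply jacobiSym.mod_left'
  exact_mod_cast h

theorem sum_Icc_one_div_le (y : ℕ) : ∑ q ∈ Finset.Icc 1 y, (1 / q : ℝ) ≤ 1 + Real.log y := by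
  have h := harmonic_le_one_add_log y
  rw [harmonic_eq_sum_Icc] at h
  push_cast at h
  simpa using h

/-- The integers `k` for which the divisor sum of the Jacobi symbol vanishes at all `k + t ^ r`
which are coprime to `W` and congruent to `1` modulo `A`. -/
def SieveExceptional (A r W k : ℕ) : Prop :=
  ∀ t : ℕ, (k + t ^ r).Coprime W → k + t ^ r ≡ 1 [MOD A] → jacobiDivisorSum A (k + t ^ r) = 0

open Classical in
/-- Exceptional integers are rare in arithmetic progressions modulo `primorial w`. -/
theorem exists_card_sieveExceptional_progression_le {A r : ℕ} (hA : Squarefree A) (hA4 : A % 4 = 3)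
    (hr : r.Prime) (hAr : ∀ p : ℕ, p.Prime → p ∣ A → ¬ p ≡ 1 [MOD r]) :
    ∃ (K : ℝ) (w₀ : ℕ), ∀ w ≥ w₀, ∀ k₀ : ℕ, ((4 ^ w) ^ (17 * r)) ^ 2 * (4 ^ w) ^ 39 ≤ k₀ →
      k₀ ≤ 2 * (((4 ^ w) ^ (17 * r)) ^ 2 * (4 ^ w) ^ 41) →
      (((Finset.range (((4 ^ w) ^ (17 * r)) ^ 2 * (4 ^ w) ^ 34)).filter fun i =>
        SieveExceptional A r (primorial w) (k₀ + primorial w * i)).card : ℝ) ≤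
      (((4 : ℝ) ^ w) ^ (17 * r)) ^ 2 * ((4 : ℝ) ^ w) ^ 34 *
        (6144 * (Real.exp ((17 * r : ℕ) * Real.log 4 / Real.log w) - 1) + K / (4 : ℝ) ^ w) := by
  obtain ⟨L, hL, hLw⟩ := exists_abs_sum_siftedJacobi_div_sub_le hA4
  refine ⟨6144 + 49152 * (A : ℝ) ^ 2 / L ^ 2 + 16 / L, ?_⟩
  have hev : ∀ᶠ w : ℕ in atTop, 4 * (A : ℝ) ≤ L * (4 : ℝ) ^ w := by
    have h := (tendsto_pow_atTop_atTop_of_one_lt (r := (4 : ℝ)) (by norm_num)).const_mul_atTop hL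
    exact h.eventually_ge_atTop _
  have hev2 : ∀ᶠ w : ℕ in atTop, ((17 * r + 23 : ℕ) : ℝ) ≤ (4 : ℝ) ^ w :=
    (tendsto_pow_atTop_atTop_of_one_lt (r := (4 : ℝ)) (by norm_num)).eventually_ge_atTop _
  obtain ⟨w₀, hw₀⟩ := eventually_atTop.1
    (((hev.and hev2).and (eventually_ge_atTop A)).and (eventually_ge_atTop 2))
  refine ⟨w₀, fun w hw k₀ hk₀ hk₀' => ?_⟩
  obtain ⟨⟨⟨hwL, hwr⟩, hwA⟩, hw2⟩ := hw₀ w hw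
  obtain ⟨t₀, ht₀, htcop, htmod⟩ := exists_add_pow_coprime_primorial hA hr hAr hwA hw2 k₀
  obtain ⟨lam, hlam, hP⟩ := hLw w
  set W := primorial w with hW
  have hWpos : 0 < W := primorial_pos w
  have hWV : W ≤ 4 ^ w := primorial_le_four_pow w
  have hAW : A ∣ W := hA.dvd_primorial.trans (primorial_dvd_primorial hwA)
  set V : ℕ := 4 ^ w with hV
  set p : ℕ := V ^ (17 * r) with hp
  have hV4 : 4 ≤ V := le_self_pow₀ (by norm_num) (by omega)
  have hV0 : 0 < V := by omega
  have hp1 : 1 ≤ p := Nat.one_le_pow _ _ hV0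
  have hVr : ((V : ℕ) : ℝ) = (4 : ℝ) ^ w := by rw [hV]; push_cast; rfl
  have hpr : ((p : ℕ) : ℝ) = ((4 : ℝ) ^ w) ^ (17 * r) := by rw [hp]; push_cast; rw [hVr]
  rw [← hpr, ← hVr]
  rw [← hVr] at hwL hwr
  set y := Nat.sqrt (k₀ + 2 * (p ^ 2 * V ^ 35)) with hy
  have hysq : y ^ 2 ≤ k₀ + 2 * (p ^ 2 * V ^ 35) := Nat.sqrt_le' _
  have hysq' : k₀ + 2 * (p ^ 2 * V ^ 35) < (y + 1) ^ 2 := Nat.lt_succ_sqrt' _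
  have hylow : p * V ^ 19 ≤ y := by
    rw [hy, Nat.le_sqrt']
    calc (p * V ^ 19) ^ 2 = p ^ 2 * V ^ 38 := by ring
      _ ≤ p ^ 2 * V ^ 39 := by gcongr <;> omega
      _ ≤ _ := by omega
  set T : ℕ → ℕ := fun j => (t₀ + W * j) ^ r with hT
  have hTV : ∀ j < V ^ 16, T j ≤ p := by
    intro j hj
    have h1 : t₀ + W * j ≤ V ^ 17 := by
      calc t₀ + W * j ≤ W * (j + 1) := by rw [mul_add, mul_one]; omega
        _ ≤ V * V ^ 16 := Nat.mul_le_mul hWV hj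
        _ = V ^ 17 := by ring
    calc T j ≤ (V ^ 17) ^ r := Nat.pow_le_pow_left h1 r
      _ = p := by rw [hp, ← pow_mul]
  have hmod : ∀ i j, k₀ + W * i + T j ≡ k₀ + t₀ ^ r [MOD W] := by
    intro i j
    have h1 : t₀ + W * j ≡ t₀ [MOD W] := by simp [Nat.ModEq]
    have h2 : k₀ + W * i ≡ k₀ [MOD W] := by simp [Nat.ModEq]
    exact h2.add (h1.pow r)
  have hcop : ∀ i j, (k₀ + W * i + T j).Coprime W := by
    intro i j
    have := (hmod i j).gcd_eq
    rw [Nat.Coprime, this]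
    exact htcop
  have hmodA : ∀ i j, k₀ + W * i + T j ≡ 1 [MOD A] := fun i j =>
    ((hmod i j).of_dvd hAW).trans htmod
  set l := |lam| with hl
  set b : ℝ := (2 : ℝ) ^ w with hb
  have hb1 : 1 ≤ b := one_le_pow₀ (by norm_num)
  have hbV : b ^ 2 = (V : ℝ) := by
    rw [hVr, hb, ← pow_mul, mul_comm, pow_mul]; norm_num
  have hb0 : 0 < b := by linarith
  have hl0 : 0 < l := by
    by_contra hc
    nlinarith
  have hVreal : (4 : ℝ) ≤ V := by exact_mod_cast hV4
  have hpreal : (1 : ℝ) ≤ p := by exact_mod_cast hp1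
  have hylowr : (p : ℝ) * (V : ℝ) ^ 19 ≤ y := by exact_mod_cast hylow
  have hV1 : (1 : ℝ) ≤ V := by linarith
  have hsmallerr : ∀ n : ℝ, (V : ℝ) ^ 2 ≤ n + 1 → 2 * A * b / (n + 1) ≤ l / 2 := by
    intro n hn
    have hn0 : 0 < n + 1 := lt_of_lt_of_le (by positivity) hn
    rw [div_le_div_iff₀ hn0 (by norm_num)]
    have h1 : 4 * A * b * b ≤ l * b * (n + 1) := by
      calc 4 * A * b * b = 4 * A * (V : ℝ) := by rw [← hbV]; ring
        _ ≤ L * V * V := by gcongr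
        _ = L * (V : ℝ) ^ 2 := by ring
        _ ≤ b * l * (n + 1) := by gcongr
        _ = _ := by ring
    have h2 : 4 * A * b ≤ l * (n + 1) := le_of_mul_le_mul_right (by linarith) hb0
    linarith
  have hyr : (y : ℝ) ^ 2 ≤ k₀ + 2 * ((p : ℝ) ^ 2 * (V : ℝ) ^ 35) := by exact_mod_cast hysq
  have hkr : (p : ℝ) ^ 2 * (V : ℝ) ^ 39 ≤ k₀ := by exact_mod_cast hk₀
  have hkr' : (k₀ : ℝ) ≤ 2 * ((p : ℝ) ^ 2 * (V : ℝ) ^ 41) := by exact_mod_cast hk₀'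
  have hpw : ∀ {m n : ℕ}, m ≤ n → (p : ℝ) ^ 2 * (V : ℝ) ^ m ≤ (p : ℝ) ^ 2 * (V : ℝ) ^ n :=
    fun h => by gcongr
  have hyv : (y : ℝ) ^ 2 ≤ 4 * ((p : ℝ) ^ 2 * (V : ℝ) ^ 41) := by
    have := hpw (show 35 ≤ 41 by norm_num)
    linarith
  have hV19 : (V : ℝ) ^ 2 ≤ y := by
    calc (V : ℝ) ^ 2 ≤ 1 * (V : ℝ) ^ 19 := by
          rw [one_mul]; exact pow_le_pow_right₀ hV1 (by norm_num)
      _ ≤ p * (V : ℝ) ^ 19 := by gcongr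
      _ ≤ y := hylowr
  have hy0 : 0 < y := lt_of_lt_of_le (by positivity) hylow
  have hlogy : 1 + Real.log y ≤ (V : ℝ) ^ 2 := by
    have h1 : (y : ℝ) ≤ (V : ℝ) ^ (17 * r + 22) := by
      have h2 : (p : ℝ) = (V : ℝ) ^ (17 * r) := by rw [hp]; push_cast; rfl
      have h3 : (y : ℝ) ^ 2 ≤ ((V : ℝ) ^ (17 * r + 22)) ^ 2 := by
        calc (y : ℝ) ^ 2 ≤ 4 * ((p : ℝ) ^ 2 * (V : ℝ) ^ 41) := hyv
          _ ≤ V * ((p : ℝ) ^ 2 * (V : ℝ) ^ 41) := by gcongr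
          _ = p ^ 2 * (V : ℝ) ^ 42 := by ring
          _ ≤ p ^ 2 * (V : ℝ) ^ 44 := hpw (by norm_num)
          _ = _ := by rw [h2]; ring
      exact le_of_sq_le_sq h3 (by positivity)
    have h4 : Real.log y ≤ (17 * r + 22 : ℕ) * Real.log V := by
      rw [← Real.log_pow]
      exact Real.log_le_log (by exact_mod_cast hy0) h1
    have h5 : Real.log V ≤ V := (Real.log_le_self (by linarith))
    calc 1 + Real.log y ≤ V + (17 * r + 22 : ℕ) * V := by
          have : ((17 * r + 22 : ℕ) : ℝ) * Real.log V ≤ (17 * r + 22 : ℕ) * V := by gcongr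
          linarith
      _ = (17 * r + 23 : ℕ) * V := by push_cast; ring
      _ ≤ V * V := by gcongr
      _ = _ := by ring
  have hWi : ∀ i < p ^ 2 * V ^ 34, W * i ≤ p ^ 2 * V ^ 35 := by
    intro i hi
    calc W * i ≤ V * (p ^ 2 * V ^ 34) := Nat.mul_le_mul hWV hi.le
      _ = _ := by ring
  have hpV : p ≤ p ^ 2 * V ^ 35 := by
    calc p = p * 1 := by ring
      _ ≤ p ^ 2 * V ^ 35 := Nat.mul_le_mul (le_self_pow₀ hp1 (by norm_num)) (Nat.one_le_pow _ _ hV0)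
  have hlamU : l ≤ 2 * A * b := by
    have := hP 0
    simpa using this
  have hmain := card_jacobiDivisorSum_eq_zero_le (A := A) (w := w) (k₀ := k₀)
    (M := p ^ 2 * V ^ 34) (J := V ^ 16) (x := k₀) (y := y) (Q := p * V ^ 14) (Z := p) T
    (l := l) (η := Real.exp ((17 * r : ℕ) * Real.log 4 / Real.log w) - 1) (U := 4 * A * b)
    (h := (V : ℝ) ^ 2) hl0 ?_ (by positivity) (by positivity) (by positivity) ?_ ?_ le_rfl ?_ ?_
    ?_ ?_ ?_ ?_ ?_ hTV ?_ (fun i _ j _ => hcop i j)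
    (fun i _ j _ => jacobiSym_eq_one_of_modEq_one (hmodA i j)) ?_
  · have hsub : ((Finset.range (p ^ 2 * V ^ 34)).filter fun i =>
        SieveExceptional A r W (k₀ + W * i)) ⊆ (Finset.range (p ^ 2 * V ^ 34)).filter fun i =>
        ∀ j < V ^ 16, jacobiDivisorSum A (k₀ + W * i + T j) = 0 := by
      intro i hi
      rw [Finset.mem_filter] at hi ⊢
      exact ⟨hi.1, fun j _ => hi.2 _ (hcop i j) (hmodA i j)⟩
    refine (Nat.cast_le.2 (Finset.card_le_card hsub)).trans ((hmain).trans ?_)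
    push_cast
    refine sieve_error_le hVreal hpreal hb1 hbV hL hlam hkr hylowr ?_ hyv ?_
    · have := hpw (show 35 ≤ 39 by norm_num)
      linarith
    · exact card_filter_le_mul_le hy0 (by positivity) hyr
  · rw [sub_nonneg]
    exact Real.one_le_exp (div_nonneg (mul_nonneg (Nat.cast_nonneg _) (Real.log_nonneg
      (by norm_num))) (Real.log_natCast_nonneg w))
  · refine le_trans ?_ hylow
    gcongr <;> omega
  · exact lt_of_lt_of_le (by positivity) hk₀
  · calc (p * V ^ 14) ^ 2 = p ^ 2 * V ^ 28 := by ring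
      _ ≤ p ^ 2 * V ^ 34 := by gcongr <;> omega
      _ ≤ _ := by omega
  · calc 4 * (p ^ 2 * V ^ 34) ≤ V * (p ^ 2 * V ^ 34) := by gcongr
      _ = p ^ 2 * V ^ 35 := by ring
      _ ≤ p ^ 2 * V ^ 38 := by gcongr <;> omega
      _ = (p * V ^ 19) ^ 2 := by ring
      _ ≤ y ^ 2 := by gcongr
  · have h1 := hsmallerr y (by linarith)
    have h2 := (hP y).trans h1
    have h3 := abs_sub_abs_le_abs_sub lam (∑ m ∈ Finset.Icc 1 y, siftedJacobi A w m / m)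
    rw [abs_sub_comm] at h3
    linarith
  · intro q hq hqQ
    have h0 : (V : ℝ) ^ 2 ≤ ((y / q : ℕ) : ℝ) + 1 := by
      have : V ^ 2 ≤ y / q := by
        rw [Nat.le_div_iff_mul_le hq]
        calc V ^ 2 * q ≤ V ^ 2 * (p * V ^ 14) := by gcongr
          _ = p * V ^ 16 := by ring
          _ ≤ p * V ^ 19 := by gcongr <;> omega
          _ ≤ y := hylow
      have : ((V ^ 2 : ℕ) : ℝ) ≤ ((y / q : ℕ) : ℝ) := by exact_mod_cast this
      push_cast at this ⊢
      linarith
    have h1 := hsmallerr _ h0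
    have h2 := (hP (y / q)).trans h1
    have h3 := abs_sub_abs_le_abs_sub (∑ m ∈ Finset.Icc 1 (y / q), siftedJacobi A w m / m) lam
    linarith
  · intro n
    have h1 := hP n
    have h2 : 2 * A * b / ((n : ℝ) + 1) ≤ 2 * A * b :=
      div_le_self (by positivity) (by linarith [(n.cast_nonneg : (0 : ℝ) ≤ n)])
    have h3 := abs_sub_abs_le_abs_sub (∑ m ∈ Finset.Icc 1 n, siftedJacobi A w m / m) lam
    linarith
  · exact (sum_Icc_one_div_le y).trans hlogy
  · intro i _ j _ hij h
    have h1 := Nat.pow_left_injective hr.ne_zero h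
    exact hij (Nat.eq_of_mul_eq_mul_left hWpos (by omega))
  · intro n hn hnp
    refine sum_rough_divisors_le hw2 hn (hnp.trans ?_)
    rw [hp, hV, ← pow_mul]
  · intro i hi j hj
    have := hWi i hi
    have := hTV j hj
    rw [← hW]
    omega

theorem sum_range_mul_eq_sum_sum {R : Type*} [AddCommMonoid R] (f : ℕ → R) (W M : ℕ) :
    ∑ k ∈ Finset.range (W * M), f k =
      ∑ b ∈ Finset.range W, ∑ i ∈ Finset.range M, f (b + W * i) := by
  induction M with
  | zero => simp
  | succ M ih =>
    rw [mul_add, mul_one, Finset.sum_range_add, ih]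
    simp_rw [Finset.sum_range_succ, Finset.sum_add_distrib]
    simp_rw [add_comm]

open Classical in
theorem card_filter_range_le_of_progressions (E : ℕ → Prop) {W M lo hi N : ℕ} {ε : ℝ}
    (hW : 0 < W) (hM : 0 < M) (hε : 0 ≤ ε) (hhi : lo + N + W ≤ hi)
    (h : ∀ k₀, lo ≤ k₀ → k₀ ≤ hi →
      (((Finset.range M).filter fun i => E (k₀ + W * i)).card : ℝ) ≤ M * ε) :
    (((Finset.range N).filter E).card : ℝ) ≤ lo + (N + (W * M : ℕ)) * ε := by
  have hblock : ∀ x, lo ≤ x → x + W ≤ hi →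
      (∑ k ∈ Finset.range (W * M), if E (x + k) then (1 : ℝ) else 0) ≤ (W * M : ℕ) * ε := by
    intro x hx hx'
    rw [sum_range_mul_eq_sum_sum (fun k => if E (x + k) then (1 : ℝ) else 0)]
    calc _ ≤ ∑ b ∈ Finset.range W, M * ε := by
          refine Finset.sum_le_sum fun b hb => ?_
          have := h (x + b) (by omega) (by have := Finset.mem_range.1 hb; omega)
          rw [Finset.card_filter] at this
          push_cast at this
          simpa only [add_assoc] using this
      _ = _ := by simp; ring
  have hq : ∀ q, (∀ q' < q, lo + W * M * q' ≤ lo + N) →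
      (∑ k ∈ Finset.range (lo + W * M * q), if E k then (1 : ℝ) else 0)
        ≤ lo + (W * M * q : ℕ) * ε := by
    intro q
    induction q with
    | zero =>
      intro _
      calc _ ≤ ∑ k ∈ Finset.range (lo + W * M * 0), (1 : ℝ) :=
            Finset.sum_le_sum fun k _ => by split_ifs <;> norm_num
        _ = _ := by simp
    | succ q ih =>
      intro hq
      have h1 := ih fun q' hq' => hq q' (by omega)
      have h2 := hblock (lo + W * M * q) (by omega) (by have := hq q (by omega); omega)
      rw [mul_add, mul_one, ← add_assoc, Finset.sum_range_add]
      push_cast at h1 h2 ⊢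
      linarith
  have hH : 0 < W * M := Nat.mul_pos hW hM
  have h1 := hq (N / (W * M) + 1) fun q' hq' => by
    have : W * M * q' ≤ W * M * (N / (W * M)) := Nat.mul_le_mul_left _ (by omega)
    have := Nat.mul_div_le N (W * M)
    omega
  have h2 : N ≤ lo + W * M * (N / (W * M) + 1) := by
    have := Nat.lt_mul_div_succ N hH
    omega
  have h3 : W * M * (N / (W * M) + 1) ≤ N + W * M := by
    have := Nat.mul_div_le N (W * M)
    rw [mul_add, mul_one]
    omega
  have h3' : ((W * M * (N / (W * M) + 1) : ℕ) : ℝ) ≤ N + (W * M : ℕ) := by exact_mod_cast h3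
  rw [Finset.card_filter]
  push_cast
  calc _ ≤ ∑ k ∈ Finset.range (lo + W * M * (N / (W * M) + 1)), (if E k then (1 : ℝ) else 0) :=
        Finset.sum_le_sum_of_subset_of_nonneg (Finset.range_subset_range.2 h2)
          fun k _ _ => by split_ifs <;> norm_num
    _ ≤ _ := h1
    _ ≤ _ := by push_cast at h3' ⊢; gcongr

open Classical in
theorem exists_card_sieveExceptional_le {A r : ℕ} (hA : Squarefree A) (hA4 : A % 4 = 3)
    (hr : r.Prime) (hAr : ∀ p : ℕ, p.Prime → p ∣ A → ¬ p ≡ 1 [MOD r]) :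
    ∃ (w : ℕ → ℕ) (δ : ℕ → ℝ), Tendsto w atTop atTop ∧ Tendsto δ atTop (nhds 0) ∧
      ∀ᶠ N in atTop, (((Finset.range (N + 1)).filter
        (SieveExceptional A r (primorial (w N)))).card : ℝ) ≤ N * δ N := by
  obtain ⟨K, w₀, hK⟩ := exists_card_sieveExceptional_progression_le hA hA4 hr hAr
  obtain ⟨C, hC⟩ : ∃ C, C = 34 * r + 40 := ⟨_, rfl⟩
  set ε : ℕ → ℝ := fun w =>
    6144 * (Real.exp ((17 * r : ℕ) * Real.log 4 / Real.log w) - 1) + K / (4 : ℝ) ^ w with hε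
  have hpow : Tendsto (fun w : ℕ => (4 : ℝ) ^ w) atTop atTop :=
    tendsto_pow_atTop_atTop_of_one_lt (by norm_num)
  have hε0 : Tendsto ε atTop (nhds 0) := by
    have h1 := (tendsto_exp_div_log_sub_one (17 * r)).const_mul (6144 : ℝ)
    have h2 : Tendsto (fun w : ℕ => K / (4 : ℝ) ^ w) atTop (nhds 0) := hpow.const_div_atTop K
    simpa [hε] using h1.add h2
  have hw : Tendsto (fun N => Nat.log (4 ^ C) N) atTop atTop := by
    refine tendsto_atTop.2 fun b => ?_
    filter_upwards [eventually_ge_atTop ((4 ^ C) ^ b)] with N hN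
    exact Nat.le_log_of_pow_le (Nat.one_lt_pow (by omega) (by norm_num)) hN
  refine ⟨fun N => Nat.log (4 ^ C) N,
    fun N => 1 / (4 : ℝ) ^ (Nat.log (4 ^ C) N) + 3 * |ε (Nat.log (4 ^ C) N)|, hw, ?_, ?_⟩
  · have h1 : Tendsto (fun w : ℕ => 1 / (4 : ℝ) ^ w + 3 * |ε w|) atTop (nhds 0) := by
      have h1 : Tendsto (fun w : ℕ => 1 / (4 : ℝ) ^ w) atTop (nhds 0) := hpow.const_div_atTop 1
      simpa using h1.add (hε0.abs.const_mul 3)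
    exact h1.comp hw
  filter_upwards [hw.eventually_ge_atTop w₀, hw.eventually_ge_atTop C, eventually_ge_atTop 1]
    with N hN hNC hN1
  set w := Nat.log (4 ^ C) N
  have hup : N < (4 ^ C) ^ (w + 1) :=
    Nat.lt_pow_succ_log_self (Nat.one_lt_pow (by omega) (by norm_num)) N
  have hlow : (4 ^ C) ^ w ≤ N := Nat.pow_log_le_self _ (by omega)
  have hKw := hK w hN
  set V := 4 ^ w with hV
  set P := (V ^ (17 * r)) ^ 2 with hP
  have hV4 : 4 ≤ V := by
    calc 4 = 4 ^ 1 := rfl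
      _ ≤ 4 ^ w := Nat.pow_le_pow_right (by norm_num) (by omega)
  have hPpos : 0 < P := by positivity
  have hVC : (4 ^ C) ^ w = P * V ^ 40 := by
    rw [← pow_mul, mul_comm C w, pow_mul, ← hV, hC, hP, ← pow_mul V (17 * r), ← pow_add]
    congr 1
    omega
  have hlow' : P * V ^ 39 * V ≤ N := by
    calc P * V ^ 39 * V = (4 ^ C) ^ w := by
          rw [hVC]; ring
      _ ≤ N := hlow
  have hup' : N + 1 ≤ P * V ^ 41 := by
    calc N + 1 ≤ (4 ^ C) ^ (w + 1) := hup
      _ = 4 ^ C * (P * V ^ 40) := by rw [pow_succ, hVC, mul_comm]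
      _ ≤ V * (P * V ^ 40) :=
          Nat.mul_le_mul_right _ (Nat.pow_le_pow_right (by norm_num) hNC)
      _ = P * V ^ 41 := by ring
  have hWV : primorial w ≤ V := primorial_le_four_pow w
  have hlo : P * V ^ 39 + V ≤ P * V ^ 41 := by
    have h1 : V ≤ P * V ^ 39 := by
      calc V = 1 * V ^ 1 := by ring
        _ ≤ P * V ^ 39 := Nat.mul_le_mul hPpos (Nat.pow_le_pow_right (by omega) (by norm_num))
    calc P * V ^ 39 + V ≤ P * V ^ 39 * 16 := by omega
      _ ≤ P * V ^ 39 * (V * V) := by gcongr; nlinarith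
      _ = P * V ^ 41 := by ring
  have hH : primorial w * (P * V ^ 34) ≤ N := by
    calc primorial w * (P * V ^ 34) ≤ V * (P * V ^ 34) := by gcongr
      _ = P * V ^ 34 * V := by ring
      _ ≤ P * V ^ 39 * V := by gcongr <;> omega
      _ ≤ N := hlow'
  have hmain := card_filter_range_le_of_progressions (SieveExceptional A r (primorial w))
    (W := primorial w) (M := P * V ^ 34) (lo := P * V ^ 39) (hi := 2 * (P * V ^ 41))
    (N := N + 1) (ε := |ε w|) (primorial_pos w) (by positivity) (abs_nonneg _) (by omega)
    (fun k₀ h1 h2 => (hKw k₀ h1 h2).trans (by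
      rw [hP, hV]
      push_cast
      refine mul_le_mul_of_nonneg_left ?_ (by positivity)
      have := le_abs_self (ε w)
      simpa [hε] using this))
  refine hmain.trans ?_
  have hVr : (0 : ℝ) < (4 : ℝ) ^ w := by positivity
  have h1 : ((P * V ^ 39 : ℕ) : ℝ) ≤ N * (1 / (4 : ℝ) ^ w) := by
    rw [mul_one_div, le_div_iff₀ hVr]
    have : ((P * V ^ 39 * V : ℕ) : ℝ) ≤ N := by exact_mod_cast hlow'
    rw [Nat.cast_mul _ V] at this
    simpa [hV] using this
  have h2 : ((primorial w * (P * V ^ 34) : ℕ) : ℝ) ≤ N := by exact_mod_cast hH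
  have h3 : (1 : ℝ) ≤ N := by exact_mod_cast hN1
  have h4 : (((N + 1 : ℕ) : ℝ) + (primorial w * (P * V ^ 34) : ℕ)) * |ε w| ≤ 3 * N * |ε w| := by
    gcongr
    push_cast at h2 ⊢
    linarith
  calc _ ≤ N * (1 / (4 : ℝ) ^ w) + 3 * N * |ε w| := add_le_add h1 h4
    _ = _ := by ring

theorem jacobiDivisorSum_mul {A m n : ℕ} (hA : A ≠ 1) (hmn : m.Coprime n) :
    jacobiDivisorSum A (m * n) = jacobiDivisorSum A m * jacobiDivisorSum A n := by
  rcases eq_or_ne A 0 with rfl | hA0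
  · simp [jacobiDivisorSum, hmn.card_divisors_mul]
  let f : ArithmeticFunction ℤ := ⟨fun n => jacobiSym n A, by
    have : NeZero A := ⟨hA0⟩
    rw [jacobiSym.eq_zero_iff_not_coprime]
    simpa using hA⟩
  have hf : f.IsMultiplicative := by
    refine ArithmeticFunction.IsMultiplicative.iff_ne_zero.2 ⟨?_, ?_⟩
    · simp [f]
    · intro m n _ _ _
      simp [f, jacobiSym.mul_left]
  have h := (hf.mul ArithmeticFunction.isMultiplicative_zeta.natCast).map_mul_of_coprime hmn
  rw [ArithmeticFunction.coe_mul_zeta_apply, ArithmeticFunction.coe_mul_zeta_apply,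
    ArithmeticFunction.coe_mul_zeta_apply] at h
  exact h

theorem even_of_jacobiDivisorSum_prime_pow_ne_zero {A p k : ℕ} (hp : p.Prime)
    (hχ : jacobiSym p A = -1) (h : jacobiDivisorSum A (p ^ k) ≠ 0) : Even k := by
  by_contra hk
  rw [Nat.not_even_iff_odd] at hk
  apply h
  rw [jacobiDivisorSum, Nat.sum_divisors_prime_pow hp]
  simp_rw [Nat.cast_pow, jacobiSym.pow_left, hχ]
  rw [neg_one_geom_sum, if_pos]
  exact hk.add_one

theorem isSquare_neg_of_jacobiSym_eq_one {A p : ℕ} (hA4 : A % 4 = 3) (hp : p.Prime) (hp2 : p ≠ 2)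
    (h : jacobiSym p A = 1) : ∃ x : ℤ, (p : ℤ) ∣ x ^ 2 + A := by
  have : Fact p.Prime := ⟨hp⟩
  have hpo : Odd p := hp.odd_of_ne_two hp2
  have hAo : Odd A := Nat.odd_iff.2 (by omega)
  have h1 : jacobiSym (-(A : ℤ)) p = 1 := by
    rw [jacobiSym.neg _ hpo]
    rcases Nat.odd_mod_four_iff.1 (Nat.odd_iff.1 hpo) with h4 | h4
    · rw [ZMod.χ₄_nat_one_mod_four h4, one_mul,
        ← jacobiSym.quadratic_reciprocity_one_mod_four h4 hAo, h]
    · rw [ZMod.χ₄_nat_three_mod_four h4]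
      have := jacobiSym.quadratic_reciprocity_three_mod_four h4 hA4
      rw [h] at this
      omega
  obtain ⟨y, hy⟩ := ZMod.isSquare_of_jacobiSym_eq_one h1
  obtain ⟨x, rfl⟩ := ZMod.intCast_surjective y
  refine ⟨x, (ZMod.intCast_zmod_eq_zero_iff_dvd _ p).1 ?_⟩
  push_cast at hy ⊢
  rw [sq, ← hy]
  ring

section QuadraticField

open NumberField

variable {K : Type*} [Field K] [NumberField K]

theorem int_of_sq_mul_squarefree {a : ℤ} (hsf : Squarefree a) {q : ℚ} {m : ℤ}
    (h : q ^ 2 * a = m) : ∃ y : ℤ, q = y := by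
  have h1 : q.num ^ 2 * a = m * (q.den : ℤ) ^ 2 := by
    have hd : (q.den : ℚ) ≠ 0 := by exact_mod_cast q.den_ne_zero
    have : (q.num : ℚ) ^ 2 * a = m * (q.den : ℚ) ^ 2 := by
      rw [← h]
      nth_rw 2 [← Rat.num_div_den q]
      field_simp
    exact_mod_cast this
  have hcop : IsCoprime ((q.den : ℤ) ^ 2) (q.num ^ 2) := by
    refine IsCoprime.pow ?_
    rw [Int.isCoprime_iff_gcd_eq_one, Int.gcd_comm]
    exact q.reduced
  have h2 : (q.den : ℤ) * q.den ∣ a := by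
    rw [← sq]
    exact hcop.dvd_of_dvd_mul_left (Dvd.intro_left m h1.symm)
  have h3 := hsf _ h2
  have h4 : q.den = 1 := by
    rcases Int.isUnit_iff.1 h3 with h | h <;> omega
  exact ⟨q.num, (Rat.den_eq_one_iff q |>.1 h4).symm⟩

theorem linearIndependent_one_sqrt {a : ℤ} (ha : a < 0) {α : K} (hα : α ^ 2 = (a : K)) :
    LinearIndependent ℚ ![(1 : K), α] := by
  rw [LinearIndependent.pair_iff]
  intro s t h
  have ht : t = 0 := by
    by_contra ht
    have h1 : α = algebraMap ℚ K (-s / t) := by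
      have ht' : algebraMap ℚ K t ≠ 0 := by simpa using ht
      rw [map_div₀, eq_div_iff ht', map_neg]
      rw [Algebra.smul_def, Algebra.smul_def, mul_one] at h
      linear_combination h
    have h2 : (-s / t) ^ 2 = (a : ℚ) := by
      apply (algebraMap ℚ K).injective
      rw [map_pow, ← h1, hα]
      simp
    have h3 : (a : ℚ) < 0 := by exact_mod_cast ha
    nlinarith [sq_nonneg (-s / t)]
  subst ht
  refine ⟨?_, rfl⟩
  simpa using h

theorem exists_coords {a : ℤ} (ha : a < 0) (hsf : Squarefree a)
    (hdeg : Module.finrank ℚ K = 2) {α : K} (hα : α ^ 2 = (a : K)) (z : 𝓞 K) :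
    ∃ X Y : ℤ, 2 * (z : K) = X + Y * α ∧ 4 * Algebra.norm ℤ z = X ^ 2 - a * Y ^ 2 := by
  obtain ⟨b, hb⟩ : ∃ b : Module.Basis (Fin 2) ℚ K, ⇑b = ![(1 : K), α] :=
    ⟨basisOfLinearIndependentOfCardEqFinrank (linearIndependent_one_sqrt ha hα)
      (by rw [hdeg, Fintype.card_fin]), coe_basisOfLinearIndependentOfCardEqFinrank _ _⟩
  have hb0 : b 0 = 1 := by rw [hb]; rfl
  have hb1 : b 1 = α := by rw [hb]; rfl
  set u := b.repr (z : K) 0 with hu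
  set v := b.repr (z : K) 1 with hv
  have hz : (z : K) = algebraMap ℚ K u + algebraMap ℚ K v * α := by
    have := b.sum_repr (z : K)
    rw [Fin.sum_univ_two, hb0, hb1, Algebra.smul_def, Algebra.smul_def, mul_one] at this
    exact this.symm
  have hzα : (z : K) * α = (v * a) • b 0 + u • b 1 := by
    rw [hz, hb0, hb1, Algebra.smul_def, Algebra.smul_def, map_mul, map_intCast]
    linear_combination (algebraMap ℚ K v) * hα
  have hM : ∀ i, Algebra.leftMulMatrix b (z : K) i 0 = b.repr (z : K) i := fun i => by
    rw [Algebra.leftMulMatrix_eq_repr_mul, hb0, mul_one]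
  have hM0 : Algebra.leftMulMatrix b (z : K) 0 1 = v * a := by
    rw [Algebra.leftMulMatrix_eq_repr_mul, hb1, hzα]
    simp
  have hM1 : Algebra.leftMulMatrix b (z : K) 1 1 = u := by
    rw [Algebra.leftMulMatrix_eq_repr_mul, hb1, hzα]
    simp
  have hnorm : ((Algebra.norm ℤ z : ℤ) : ℚ) = u ^ 2 - a * v ^ 2 := by
    rw [Algebra.coe_norm_int, Algebra.norm_eq_matrix_det b, Matrix.det_fin_two, hM, hM, hM0, hM1]
    ring
  have htr : ((Algebra.trace ℤ (𝓞 K) z : ℤ) : ℚ) = 2 * u := by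
    rw [Algebra.coe_trace_int, Algebra.trace_eq_matrix_trace b, Matrix.trace_fin_two, hM, hM1]
    ring
  obtain ⟨Y, hY⟩ := int_of_sq_mul_squarefree hsf (q := 2 * v)
    (m := (Algebra.trace ℤ (𝓞 K) z) ^ 2 - 4 * Algebra.norm ℤ z) (by
      push_cast
      rw [hnorm, htr]
      ring)
  refine ⟨Algebra.trace ℤ (𝓞 K) z, Y, ?_, ?_⟩
  · have h1 : algebraMap ℚ K (2 * u) = (Algebra.trace ℤ (𝓞 K) z : ℤ) := by
      rw [← htr]; simp
    have h2 : algebraMap ℚ K (2 * v) = (Y : ℤ) := by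
      rw [hY]; simp
    rw [← h1, ← h2, hz, map_mul, map_mul]
    simp only [map_ofNat]
    ring
  · have : (4 : ℚ) * (Algebra.norm ℤ z : ℤ) = (Algebra.trace ℤ (𝓞 K) z : ℤ) ^ 2 - a * Y ^ 2 := by
      rw [hnorm, htr, ← hY]
      ring
    exact_mod_cast this

end QuadraticField

section QuadraticIdeals

open NumberField

/-- `δ` is a square root of `-A` in `𝓞 K`, and every algebraic integer of `K` has the form
`(X + Y * δ) / 2` with `X`, `Y` integers and norm `(X ^ 2 + A * Y ^ 2) / 4`, where
`(1 + δ) / 2` is one of them. -/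
structure HasHalfIntegerCoords {K : Type*} [Field K] [NumberField K] (A : ℕ) (δ : 𝓞 K) : Prop where
  sq_eq : δ ^ 2 = -(A : 𝓞 K)
  exists_half : ∃ ω : 𝓞 K, 2 * ω = 1 + δ
  exists_coords : ∀ z : 𝓞 K, ∃ X Y : ℤ,
    2 * z = X + Y * δ ∧ 4 * Algebra.norm ℤ z = X ^ 2 + A * Y ^ 2

variable {K : Type*} [Field K] [NumberField K]

theorem exists_hasHalfIntegerCoords {a : ℤ} (ha : a < 0) (hsf : Squarefree a) (ha4 : a % 4 = 1)
    (hdeg : Module.finrank ℚ K = 2) {α : K} (hα : α ^ 2 = (a : K)) :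
    ∃ δ : 𝓞 K, HasHalfIntegerCoords a.natAbs δ := by
  obtain ⟨c, hc⟩ : ∃ c : ℤ, a = 1 + 4 * c := ⟨a / 4, by omega⟩
  have haA : (a.natAbs : ℤ) = -a := by omega
  have h2 : (2 : K) ≠ 0 := two_ne_zero
  have hω : IsIntegral ℤ ((1 + α) / 2) := by
    refine ⟨Polynomial.X ^ 2 - Polynomial.X - (Polynomial.C c : Polynomial ℤ), ?_, ?_⟩
    · monicity!
    · have hcK : (a : K) = 1 + 4 * c := by rw [hc]; push_cast; ring
      rw [Polynomial.eval₂_sub, Polynomial.eval₂_sub, Polynomial.eval₂_X_pow, Polynomial.eval₂_X,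
        Polynomial.eval₂_C, eq_intCast]
      field_simp
      linear_combination hα + hcK
  obtain ⟨ω, hω'⟩ : ∃ ω : 𝓞 K, algebraMap (𝓞 K) K ω = (1 + α) / 2 := ⟨⟨_, hω⟩, rfl⟩
  have hδ : algebraMap (𝓞 K) K (2 * ω - 1) = α := by
    rw [map_sub, map_mul, hω', map_one, map_ofNat]
    field_simp
    ring
  have haK : ((a.natAbs : ℕ) : K) = -(a : K) := by
    rw [← Int.cast_natCast, haA]; push_cast; rfl
  refine ⟨2 * ω - 1, ?_, ⟨ω, by ring⟩, fun z => ?_⟩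
  · apply RingOfIntegers.coe_injective
    rw [map_pow, hδ, hα]
    rw [map_neg, map_natCast, haK, neg_neg]
  · obtain ⟨X, Y, h1, h2⟩ := exists_coords ha hsf hdeg hα z
    refine ⟨X, Y, ?_, ?_⟩
    · apply RingOfIntegers.coe_injective
      rw [map_add, map_mul, map_mul, hδ, map_ofNat, map_intCast, map_intCast]
      exact h1
    · rw [haA]
      linarith

namespace HasHalfIntegerCoords

variable {A : ℕ} {δ : 𝓞 K}

theorem coords_eq_zero (h : HasHalfIntegerCoords A δ) (hA : 0 < A) {X Y : ℤ}
    (hXY : (X : 𝓞 K) + Y * δ = 0) : X = 0 ∧ Y = 0 := by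
  have h1 : ((X ^ 2 + A * Y ^ 2 : ℤ) : 𝓞 K) = 0 := by
    push_cast
    linear_combination (X - Y * δ) * hXY + Y ^ 2 * h.sq_eq
  have h2 : X ^ 2 + A * Y ^ 2 = 0 := by exact_mod_cast h1
  have hA' : (0 : ℤ) < A := by exact_mod_cast hA
  have h3 : X ^ 2 = 0 := by nlinarith [sq_nonneg X, mul_nonneg hA'.le (sq_nonneg Y)]
  have h4 : (A : ℤ) * Y ^ 2 = 0 := by linarith
  refine ⟨pow_eq_zero_iff (two_ne_zero) |>.1 h3, ?_⟩
  exact pow_eq_zero_iff (two_ne_zero) |>.1 ((mul_eq_zero.1 h4).resolve_left hA'.ne')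

theorem norm_of_coords (h : HasHalfIntegerCoords A δ) (hA : 0 < A) {z : 𝓞 K} {X Y : ℤ}
    (hz : 2 * z = X + Y * δ) : 4 * Algebra.norm ℤ z = X ^ 2 + A * Y ^ 2 := by
  obtain ⟨X', Y', h1, h2⟩ := h.exists_coords z
  obtain ⟨h3, h4⟩ := h.coords_eq_zero hA (X := X' - X) (Y := Y' - Y) (by
    push_cast
    linear_combination hz - h1)
  rw [h2, show X' = X by omega, show Y' = Y by omega]

theorem norm_nonneg (h : HasHalfIntegerCoords A δ) (z : 𝓞 K) : 0 ≤ Algebra.norm ℤ z := by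
  obtain ⟨X, Y, -, h2⟩ := h.exists_coords z
  have : (0 : ℤ) ≤ A * Y ^ 2 := by positivity
  nlinarith [sq_nonneg X]

theorem norm_natCast (h : HasHalfIntegerCoords A δ) (hA : 0 < A) (n : ℕ) :
    Algebra.norm ℤ (n : 𝓞 K) = (n : ℤ) ^ 2 := by
  have := h.norm_of_coords hA (z := n) (X := 2 * n) (Y := 0) (by push_cast; ring)
  linarith

theorem norm_sqrt (h : HasHalfIntegerCoords A δ) (hA : 0 < A) : Algebra.norm ℤ δ = A := by
  have := h.norm_of_coords hA (z := δ) (X := 0) (Y := 2) (by push_cast; ring)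
  linarith

theorem absNorm_span_natCast (h : HasHalfIntegerCoords A δ) (hA : 0 < A) (n : ℕ) :
    Ideal.absNorm (Ideal.span {(n : 𝓞 K)}) = n ^ 2 := by
  rw [Ideal.absNorm_span_singleton, h.norm_natCast hA, ← Int.natCast_pow, Int.natAbs_natCast]

theorem absNorm_span_sqrt (h : HasHalfIntegerCoords A δ) (hA : 0 < A) :
    Ideal.absNorm (Ideal.span {δ}) = A := by
  rw [Ideal.absNorm_span_singleton, h.norm_sqrt hA, Int.natAbs_natCast]

theorem sq_sub_mul_add_norm_eq_zero (h : HasHalfIntegerCoords A δ) {z : 𝓞 K} {X Y : ℤ}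
    (hz : 2 * z = X + Y * δ) (hN : 4 * Algebra.norm ℤ z = X ^ 2 + A * Y ^ 2) :
    z ^ 2 - X * z + (Algebra.norm ℤ z : ℤ) = 0 := by
  have h4 : (4 : 𝓞 K) ≠ 0 := by norm_num
  apply mul_left_cancel₀ h4
  have hN' : (4 : 𝓞 K) * (Algebra.norm ℤ z : ℤ) = (X : 𝓞 K) ^ 2 + A * (Y : 𝓞 K) ^ 2 := by
    exact_mod_cast congrArg (Int.cast : ℤ → 𝓞 K) hN
  rw [mul_add, hN', mul_zero]
  linear_combination (2 * z - X + Y * δ) * hz + Y ^ 2 * h.sq_eq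

end HasHalfIntegerCoords

theorem eq_of_dvd_of_absNorm_eq {I J : Ideal (𝓞 K)} (hIJ : I ∣ J) (hJ : J ≠ ⊥)
    (hN : Ideal.absNorm I = Ideal.absNorm J) : I = J := by
  obtain ⟨Q, rfl⟩ := hIJ
  have h0 : Ideal.absNorm I ≠ 0 := by
    rw [hN]
    exact Ideal.absNorm_eq_zero_iff.not.2 hJ
  rw [map_mul] at hN
  have h1 : Ideal.absNorm Q = 1 := by
    apply Nat.eq_of_mul_eq_mul_left (Nat.pos_of_ne_zero h0)
    rw [← hN, mul_one]
  rw [Ideal.absNorm_eq_one_iff.1 h1, Ideal.mul_top]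

theorem isPrincipal_of_mul_span_singleton {I : Ideal (𝓞 K)} {c β : 𝓞 K} (hc : c ≠ 0)
    (h : I * Ideal.span {c} = Ideal.span {β}) : I.IsPrincipal := by
  obtain ⟨γ, rfl⟩ : c ∣ β := by
    rw [← Ideal.span_singleton_le_span_singleton, ← h]
    exact Ideal.mul_le_right (I := I) (J := Ideal.span {c})
  refine ⟨γ, ?_⟩
  rw [← Ideal.span_singleton_mul_span_singleton, mul_comm] at h
  exact mul_left_cancel₀ (by simpa using hc) h

end QuadraticIdeals

section QuadraticIdealNorms

open NumberField

variable {K : Type*} [Field K] [NumberField K]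

namespace HasHalfIntegerCoords

variable {A : ℕ} {δ : 𝓞 K}

theorem not_natCast_dvd_add_mul_sqrt (h : HasHalfIntegerCoords A δ) (hA : 0 < A) {p : ℕ}
    (hp : 2 < p) {x y : ℤ} (hy : y = 1 ∨ y = -1) : ¬ (p : 𝓞 K) ∣ x + y * δ := by
  rintro ⟨γ, hγ⟩
  obtain ⟨X, Y, h1, -⟩ := h.exists_coords γ
  obtain ⟨-, h3⟩ := h.coords_eq_zero hA (X := 2 * x - p * X) (Y := 2 * y - p * Y) (by
    push_cast
    linear_combination 2 * hγ + p * h1)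
  have h4 : (p : ℤ) ∣ 2 * y := ⟨Y, by linarith⟩
  have h5 : (p : ℤ) ∣ 2 := by
    rcases hy with rfl | rfl
    · simpa using h4
    · simpa using h4
  have := Int.le_of_dvd (by norm_num) h5
  omega

theorem exists_absNorm_eq_prime (h : HasHalfIntegerCoords A δ) (hA4 : A % 4 = 3) {p : ℕ}
    (hp : p.Prime) (hp2 : p ≠ 2) (hχ : jacobiSym p A = 1) :
    ∃ I : Ideal (𝓞 K), Ideal.absNorm I = p := by
  have hA : 0 < A := by omega
  have hp3 : 2 < p := lt_of_le_of_ne hp.two_le hp2.symm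
  obtain ⟨x, c, hc⟩ := isSquare_neg_of_jacobiSym_eq_one hA4 hp hp2 hχ
  have hcK : (x : 𝓞 K) ^ 2 + A = p * c := by exact_mod_cast congrArg (Int.cast : ℤ → 𝓞 K) hc
  set J : Ideal (𝓞 K) := Ideal.span {(p : 𝓞 K), x + ((-1 : ℤ) : 𝓞 K) * δ} with hJ
  have hpJ : (p : 𝓞 K) ∈ J := Ideal.subset_span (by simp)
  have hxJ : x + ((-1 : ℤ) : 𝓞 K) * δ ∈ J := Ideal.subset_span (by simp)
  have hle : Ideal.span {(p : 𝓞 K)} ≤ J := (Ideal.span_singleton_le_iff_mem _).2 hpJ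
  have hp0 : Ideal.span {(p : 𝓞 K)} ≠ ⊥ := by
    simpa using hp.ne_zero
  have hdvd : Ideal.absNorm J ∣ p ^ 2 := by
    rw [← h.absNorm_span_natCast hA]
    exact Ideal.absNorm_dvd_absNorm_of_le hle
  obtain ⟨k, hk, hk'⟩ := (Nat.dvd_prime_pow hp).1 hdvd
  refine ⟨J, ?_⟩
  interval_cases k
  · exfalso
    have h1 : (1 : 𝓞 K) ∈ J := by
      rw [pow_zero, Ideal.absNorm_eq_one_iff] at hk'
      rw [hk']; trivial
    obtain ⟨u, v, huv⟩ := Ideal.mem_span_pair.1 h1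
    refine h.not_natCast_dvd_add_mul_sqrt hA hp3 (x := x) (y := 1) (Or.inl rfl)
      ⟨u * (x + δ) + c * v, ?_⟩
    push_cast at huv ⊢
    linear_combination -(x + δ) * huv + v * hcK - v * h.sq_eq
  · simpa using hk'
  · exfalso
    have h1 : J = Ideal.span {(p : 𝓞 K)} :=
      eq_of_dvd_of_absNorm_eq (Ideal.dvd_iff_le.2 hle) hp0
        (hk'.trans (h.absNorm_span_natCast hA p).symm)
    rw [h1, Ideal.mem_span_singleton] at hxJ
    exact h.not_natCast_dvd_add_mul_sqrt hA hp3 (Or.inr rfl) hxJ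

theorem exists_absNorm_eq (h : HasHalfIntegerCoords A δ) (hA4 : A % 4 = 3) {n : ℕ}
    (hn : n.Coprime (2 * A)) (hR : jacobiDivisorSum A n ≠ 0) :
    ∃ I : Ideal (𝓞 K), Ideal.absNorm I = n := by
  have hA : 0 < A := by omega
  have : NeZero A := ⟨hA.ne'⟩
  induction n using Nat.recOnPosPrimePosCoprime with
  | zero => simp [jacobiDivisorSum] at hR
  | one => exact ⟨⊤, Ideal.absNorm_top⟩
  | prime_pow p k hp hk =>
    have hpc : p.Coprime (2 * A) := Nat.Coprime.coprime_dvd_left (dvd_pow_self p hk.ne') hn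
    have hp2 : p ≠ 2 := by
      rintro rfl
      have := Nat.Coprime.coprime_dvd_right (Dvd.intro A rfl) hpc
      norm_num at this
    have hpA : p.Coprime A := Nat.Coprime.coprime_dvd_right (Dvd.intro_left 2 rfl) hpc
    rcases jacobiSym.trichotomy p A with h0 | h1 | h1
    · rw [jacobiSym.eq_zero_iff_not_coprime] at h0
      exact absurd hpA (by simpa using h0)
    · obtain ⟨I, hI⟩ := h.exists_absNorm_eq_prime hA4 hp hp2 h1
      exact ⟨I ^ k, by rw [map_pow, hI]⟩
    · obtain ⟨m, rfl⟩ := even_of_jacobiDivisorSum_prime_pow_ne_zero hp h1 hR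
      refine ⟨Ideal.span {(p : 𝓞 K)} ^ m, ?_⟩
      rw [map_pow, h.absNorm_span_natCast hA, ← pow_mul, two_mul]
  | coprime m n hm hn' hmn ihm ihn =>
    rw [jacobiDivisorSum_mul (by omega) hmn] at hR
    obtain ⟨I, hI⟩ := ihm (Nat.Coprime.coprime_mul_right hn) (left_ne_zero_of_mul hR)
    obtain ⟨J, hJ⟩ := ihn (Nat.Coprime.coprime_mul_left hn) (right_ne_zero_of_mul hR)
    exact ⟨I * J, by rw [map_mul, hI, hJ]⟩

theorem isSquare_absNorm_of_isPrincipal (h : HasHalfIntegerCoords A δ) {q : ℕ} (hq : q.Prime)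
    (hq2 : q ≠ 2) (hqA : q ∣ A) {I : Ideal (𝓞 K)} (hI : I.IsPrincipal) :
    IsSquare (Ideal.absNorm I : ZMod q) := by
  have : Fact q.Prime := ⟨hq⟩
  obtain ⟨z, rfl⟩ := hI
  obtain ⟨X, Y, -, hN⟩ := h.exists_coords z
  have h1 : ((Ideal.absNorm (Ideal.span {z}) : ℕ) : ℤ) = Algebra.norm ℤ z := by
    rw [Ideal.absNorm_span_singleton, Int.natAbs_of_nonneg (h.norm_nonneg z)]
  have h2 : (2 : ZMod q) ≠ 0 := by
    intro h2
    have : q ∣ 2 := (ZMod.natCast_eq_zero_iff 2 q).1 (by exact_mod_cast h2)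
    exact hq2 ((Nat.prime_dvd_prime_iff_eq hq Nat.prime_two).1 this)
  have h3 : (4 : ZMod q) * (Ideal.absNorm (Ideal.span {z}) : ℕ) = (X : ZMod q) ^ 2 := by
    have h4 := congrArg (Int.cast : ℤ → ZMod q) hN
    rw [← h1] at h4
    push_cast at h4
    rw [h4, (ZMod.natCast_eq_zero_iff A q).2 hqA]
    ring
  refine ⟨X / 2, ?_⟩
  change ((Ideal.absNorm (Ideal.span {z}) : ℕ) : ZMod q) = _
  field_simp
  linear_combination h3

end HasHalfIntegerCoords

end QuadraticIdealNorms

section QuadraticClassGroup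

open NumberField

variable {K : Type*} [Field K] [NumberField K]

namespace HasHalfIntegerCoords

variable {A : ℕ} {δ : 𝓞 K}

theorem dvd_span_sqrt_of_sq_eq (h : HasHalfIntegerCoords A δ) (hA : 0 < A) {u : ℕ}
    (hu : Squarefree u) {J : Ideal (𝓞 K)} (hJ : J ^ 2 = Ideal.span {(u : 𝓞 K)}) :
    Ideal.absNorm J = u ∧ J ∣ Ideal.span {δ} := by
  have hJu : Ideal.absNorm J = u := by
    have h1 := congrArg Ideal.absNorm hJ
    rw [map_pow, h.absNorm_span_natCast hA] at h1
    exact Nat.pow_left_injective two_ne_zero h1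
  refine ⟨hJu, ?_⟩
  have htrace : ∀ x ∈ J, ∀ X Y : ℤ, 2 * x = X + Y * δ → (u : ℤ) ∣ X := by
    intro x hx X Y hXY
    have hN : (u : ℤ) ∣ Algebra.norm ℤ x := by
      rw [← hJu]
      exact Ideal.absNorm_dvd_norm_of_mem hx
    obtain ⟨N, hN⟩ := hN
    obtain ⟨γ, hγ⟩ : (u : 𝓞 K) ∣ x ^ 2 := by
      rw [← Ideal.mem_span_singleton, ← hJ]
      exact Ideal.pow_mem_pow hx 2
    obtain ⟨X', Y', hX', -⟩ := h.exists_coords γ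
    have h1 := h.sq_sub_mul_add_norm_eq_zero hXY (h.norm_of_coords hA hXY)
    rw [hN] at h1
    obtain ⟨h2, -⟩ := h.coords_eq_zero hA (X := X ^ 2 - 2 * (u * N) - u * X')
      (Y := X * Y - u * Y') (by
        push_cast at h1 ⊢
        linear_combination 2 * hγ - 2 * h1 + u * hX' - X * hXY)
    have h3 : (u : ℤ) ∣ X ^ 2 := ⟨2 * N + X', by linarith⟩
    exact ((Int.squarefree_natCast.2 hu).dvd_pow_iff_dvd two_ne_zero).1 h3
  obtain ⟨ω, hω⟩ := h.exists_half
  have h2 : (2 : 𝓞 K) ≠ 0 := two_ne_zero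
  have hmul : ∀ x ∈ J, (u : 𝓞 K) ∣ x * δ := by
    intro x hx
    obtain ⟨X, Y, hXY, -⟩ := h.exists_coords x
    obtain ⟨X', Y', hXY', -⟩ := h.exists_coords (x * ω)
    obtain ⟨T, rfl⟩ := htrace x hx X Y hXY
    obtain ⟨T', rfl⟩ := htrace _ (J.mul_mem_right ω hx) X' Y' hXY'
    obtain ⟨h3, -⟩ := h.coords_eq_zero hA (X := 2 * (u * T') - u * T + A * Y)
      (Y := 2 * Y' - u * T - Y) (by
        push_cast at hXY hXY' ⊢
        linear_combination (1 + δ) * hXY + 2 * x * hω - 2 * hXY' + Y * h.sq_eq)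
    have h3' : 2 * ((u : 𝓞 K) * T') - u * T + A * Y = 0 := by
      exact_mod_cast congrArg (Int.cast : ℤ → 𝓞 K) h3
    refine ⟨T * (ω - 1) + T', mul_left_cancel₀ h2 ?_⟩
    push_cast at hXY
    linear_combination δ * hXY - u * T * hω - h3' + Y * h.sq_eq
  have hJ0 : J ≠ ⊥ := by
    rintro rfl
    rw [Ideal.absNorm_bot] at hJu
    exact hu.ne_zero hJu.symm
  have hle : J * J ∣ J * Ideal.span {δ} := by
    rw [← sq, hJ, Ideal.dvd_iff_le, Ideal.mul_le]
    intro x hx y hy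
    obtain ⟨c, rfl⟩ := Ideal.mem_span_singleton.1 hy
    rw [Ideal.mem_span_singleton, ← mul_assoc]
    exact (hmul x hx).mul_right c
  exact (mul_dvd_mul_iff_left hJ0).1 hle

theorem isPrincipal_of_sq_eq_span_natCast (h : HasHalfIntegerCoords A δ) (hA : A.Prime) {m : ℕ}
    {J : Ideal (𝓞 K)} (hm : m ≠ 0) (hJ : J ^ 2 = Ideal.span {(m : 𝓞 K)}) : J.IsPrincipal := by
  obtain ⟨u, s, rfl, hu⟩ := Nat.sq_mul_squarefree m
  have hs : s ≠ 0 := by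
    rintro rfl
    simp at hm
  have hs0 : Ideal.span {(s : 𝓞 K)} ≠ ⊥ := by simpa using hs
  have hsq : Ideal.span {((s ^ 2 * u : ℕ) : 𝓞 K)} =
      Ideal.span {(s : 𝓞 K)} ^ 2 * Ideal.span {(u : 𝓞 K)} := by
    rw [Ideal.span_singleton_pow, Ideal.span_singleton_mul_span_singleton]
    push_cast
    rfl
  rw [hsq] at hJ
  obtain ⟨J', rfl⟩ : Ideal.span {(s : 𝓞 K)} ∣ J :=
    (UniqueFactorizationMonoid.pow_dvd_pow_iff_dvd two_ne_zero).1 (Dvd.intro _ hJ.symm)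
  rw [mul_pow] at hJ
  have hJ' := mul_left_cancel₀ (pow_ne_zero 2 hs0) hJ
  obtain ⟨hu', hdvd⟩ := h.dvd_span_sqrt_of_sq_eq hA.pos hu hJ'
  have hδ : Ideal.absNorm (Ideal.span {δ}) = A := h.absNorm_span_sqrt hA.pos
  have huA : u ∣ A := by
    rw [← hu', ← hδ]
    exact Ideal.absNorm_dvd_absNorm_of_le (Ideal.dvd_iff_le.1 hdvd)
  obtain ⟨c, rfl⟩ : ∃ c : 𝓞 K, J' = Ideal.span {c} := by
    rcases (Nat.dvd_prime hA).1 huA with h1 | h1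
    · refine ⟨1, ?_⟩
      rw [Ideal.span_singleton_one, ← Ideal.absNorm_eq_one_iff, hu', h1]
    · refine ⟨δ, eq_of_dvd_of_absNorm_eq hdvd ?_ (by rw [hu', hδ, h1])⟩
      intro h0
      rw [h0, Ideal.absNorm_bot] at hδ
      exact hA.ne_zero hδ.symm
  exact ⟨_, Ideal.span_singleton_mul_span_singleton _ _⟩

theorem isPrincipal_of_sq_isPrincipal (h : HasHalfIntegerCoords A δ) (hA : A.Prime)
    {I : Ideal (𝓞 K)} (hI0 : I ≠ ⊥) (hI : (I ^ 2).IsPrincipal) : I.IsPrincipal := by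
  obtain ⟨n, hn⟩ : ∃ n, Ideal.absNorm I = n := ⟨_, rfl⟩
  have hn0 : n ≠ 0 := by
    rw [← hn]
    exact Ideal.absNorm_eq_zero_iff.not.2 hI0
  obtain ⟨z, hz, hzn⟩ : ∃ z : 𝓞 K, I ^ 2 = Ideal.span {z} ∧ z + n ≠ 0 := by
    obtain ⟨z, hz⟩ := hI
    by_cases hzn : z + n = 0
    · refine ⟨-z, by rw [Ideal.span_singleton_neg]; exact hz, ?_⟩
      rw [show z = -(n : 𝓞 K) by linear_combination hzn, neg_neg]
      exact_mod_cast (by omega : n + n ≠ 0)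
    · exact ⟨z, hz, hzn⟩
  have hnorm : Algebra.norm ℤ z = (n : ℤ) ^ 2 := by
    have h1 := congrArg Ideal.absNorm hz
    rw [map_pow, hn, Ideal.absNorm_span_singleton] at h1
    rw [← Int.natAbs_of_nonneg (h.norm_nonneg z), ← h1]
    push_cast
    rfl
  obtain ⟨X, Y, hXY, hN⟩ := h.exists_coords z
  have h1 := h.sq_sub_mul_add_norm_eq_zero hXY hN
  rw [hnorm] at h1
  have hβ : (z + n) ^ 2 = z * (X + 2 * n : ℤ) := by
    push_cast at h1 ⊢
    linear_combination h1
  have hm0 : X + 2 * n ≠ 0 := by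
    intro h0
    rw [h0, Int.cast_zero, mul_zero] at hβ
    exact hzn (pow_eq_zero_iff two_ne_zero |>.1 hβ)
  have hspan : Ideal.span {z + (n : 𝓞 K)} ^ 2 =
      I ^ 2 * Ideal.span {((X + 2 * n).natAbs : 𝓞 K)} := by
    rw [hz, Ideal.span_singleton_pow, hβ, Ideal.span_singleton_mul_span_singleton]
    rcases Int.natAbs_eq (X + 2 * n) with h2 | h2
    · nth_rw 1 [h2]
      simp
    · nth_rw 1 [h2]
      rw [← Ideal.span_singleton_neg]
      simp
  obtain ⟨J, hJ⟩ : I ∣ Ideal.span {z + (n : 𝓞 K)} :=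
    (UniqueFactorizationMonoid.pow_dvd_pow_iff_dvd two_ne_zero).1 (Dvd.intro _ hspan.symm)
  have hJ2 : J ^ 2 = Ideal.span {((X + 2 * n).natAbs : 𝓞 K)} := by
    rw [hJ, mul_pow] at hspan
    exact mul_left_cancel₀ (pow_ne_zero 2 hI0) hspan
  obtain ⟨c, rfl⟩ := h.isPrincipal_of_sq_eq_span_natCast hA (Int.natAbs_ne_zero.2 hm0) hJ2
  refine isPrincipal_of_mul_span_singleton (c := c) ?_ hJ.symm
  rintro rfl
  apply hzn
  rw [← Ideal.span_singleton_eq_bot, hJ]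
  simp

end HasHalfIntegerCoords

theorem isPrincipal_mul_of_classNumber_le_two (hclass : classNumber K ≤ 2) {I J : Ideal (𝓞 K)}
    (hI0 : I ≠ ⊥) (hJ0 : J ≠ ⊥) (hI : ¬ I.IsPrincipal) (hJ : ¬ J.IsPrincipal) :
    (I * J).IsPrincipal := by
  classical
  have hI' := mem_nonZeroDivisors_of_ne_zero hI0
  have hJ' := mem_nonZeroDivisors_of_ne_zero hJ0
  rw [← ClassGroup.mk0_eq_one_iff (mul_mem hI' hJ')]
  rw [← ClassGroup.mk0_eq_one_iff hI'] at hI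
  rw [← ClassGroup.mk0_eq_one_iff hJ'] at hJ
  change ClassGroup.mk0 (⟨I, hI'⟩ * ⟨J, hJ'⟩) = 1
  rw [map_mul]
  set x := ClassGroup.mk0 ⟨I, hI'⟩
  set y := ClassGroup.mk0 ⟨J, hJ'⟩
  by_contra hxy
  have h3 : ({1, x, x * y} : Finset (ClassGroup (𝓞 K))).card = 3 := by
    refine Finset.card_eq_three.2 ⟨1, x, x * y, Ne.symm hI, Ne.symm hxy, ?_, rfl⟩
    intro h
    exact hJ (mul_eq_left.1 h.symm)
  have := Finset.card_le_univ ({1, x, x * y} : Finset (ClassGroup (𝓞 K)))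
  rw [h3] at this
  exact absurd (this.trans hclass) (by norm_num)

end QuadraticClassGroup

theorem exists_nat_jacobiSym_eq_neg_one {p : ℕ} (hp : p.Prime) (hp2 : p ≠ 2) :
    ∃ x : ℕ, jacobiSym x p = -1 := by
  have : Fact p.Prime := ⟨hp⟩
  obtain ⟨y, hy⟩ := FiniteField.exists_nonsquare (F := ZMod p) (by rwa [ZMod.ringChar_zmod_n])
  refine ⟨y.val, ?_⟩
  rw [← jacobiSym.legendreSym.to_jacobiSym, legendreSym.eq_neg_one_iff]
  simpa using hy

theorem exists_prime_jacobiSym_eq {A : ℕ} (hsf : Squarefree A) (hA : Odd A) (hA1 : A ≠ 1)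
    (hAp : ¬ A.Prime) : ∃ p ℓ : ℕ, p.Prime ∧ p ∣ A ∧ ℓ.Prime ∧ 2 < ℓ ∧
      jacobiSym ℓ A = 1 ∧ jacobiSym ℓ p = -1 := by
  obtain ⟨p, hp, B, rfl⟩ := Nat.exists_prime_and_dvd hA1
  have hB1 : B ≠ 1 := by
    rintro rfl
    exact hAp (by simpa using hp)
  obtain ⟨q, hq, C, rfl⟩ := Nat.exists_prime_and_dvd hB1
  have hpqC : p.Coprime (q * C) := Nat.coprime_of_squarefree_mul hsf
  have hqC : q.Coprime C := Nat.coprime_of_squarefree_mul (Squarefree.of_mul_right hsf)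
  have hpo : p ≠ 2 := by
    rintro rfl
    exact absurd hA (by simp)
  have hqo : q ≠ 2 := by
    rintro rfl
    exact absurd hA (by simp [parity_simps])
  obtain ⟨x, hx⟩ := exists_nat_jacobiSym_eq_neg_one hp hpo
  obtain ⟨y, hy⟩ := exists_nat_jacobiSym_eq_neg_one hq hqo
  obtain ⟨d, hd⟩ := Nat.chineseRemainder hqC y 1
  obtain ⟨c, hc⟩ := Nat.chineseRemainder hpqC x d
  have hcongr : ∀ {m s t : ℕ}, s ≡ t [MOD m] → jacobiSym s m = jacobiSym t m := fun h =>
    jacobiSym.mod_left' (by exact_mod_cast (Int.natCast_modEq_iff.2 h))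
  have hcqC : c ≡ d [MOD q * C] := hc.2
  have hJp : ∀ {s}, s ≡ c [MOD p * (q * C)] → jacobiSym s p = -1 := fun hs => by
    rw [hcongr ((hs.of_mul_right _).trans hc.1), hx]
  have hJq : ∀ {s}, s ≡ c [MOD p * (q * C)] → jacobiSym s q = -1 := fun hs => by
    rw [hcongr ((((hs.of_mul_left p).trans hcqC).of_mul_right _).trans hd.1), hy]
  have hJC : ∀ {s}, s ≡ c [MOD p * (q * C)] → jacobiSym s C = 1 := fun hs => by
    rw [hcongr ((((hs.of_mul_left p).trans hcqC).of_mul_left q).trans hd.2)]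
    simp
  have hA0 : p * (q * C) ≠ 0 := hsf.ne_zero
  have : NeZero (p * (q * C)) := ⟨hA0⟩
  have : NeZero p := ⟨hp.ne_zero⟩
  have : NeZero q := ⟨hq.ne_zero⟩
  have : NeZero C := ⟨by rintro rfl; simp at hA0⟩
  have hJ : ∀ {s : ℕ}, s ≡ c [MOD p * (q * C)] → jacobiSym s (p * (q * C)) = 1 := fun hs => by
    rw [jacobiSym.mul_right, jacobiSym.mul_right, hJp hs, hJq hs, hJC hs]
    norm_num
  have hcop : c.Coprime (p * (q * C)) := by
    have h1 := hJ (Nat.ModEq.refl c)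
    by_contra h2
    have h3 := (jacobiSym.eq_zero_iff_not_coprime (a := c) (b := p * (q * C))).2
      (by rwa [Int.gcd_natCast_natCast])
    omega
  obtain ⟨ℓ, hℓ2, hℓ, hℓc⟩ := Nat.forall_exists_prime_gt_and_modEq 2 hA0 hcop
  exact ⟨p, ℓ, hp, Dvd.intro _ rfl, hℓ, hℓ2, hJ hℓc, hJp hℓc⟩

section QuadraticNormEquation

open NumberField

variable {K : Type*} [Field K] [NumberField K] {A : ℕ} {δ : 𝓞 K}

theorem HasHalfIntegerCoords.exists_norm_eq (h : HasHalfIntegerCoords A δ) (hA4 : A % 4 = 3)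
    (hsf : Squarefree A) (hclass : classNumber K ≤ 2) {n : ℕ} (hn : n.Coprime (2 * A))
    (hn1 : n ≡ 1 [MOD A]) (hR : jacobiDivisorSum A n ≠ 0) :
    ∃ z : 𝓞 K, Algebra.norm ℤ z = n := by
  obtain ⟨I, hI⟩ := h.exists_absNorm_eq hA4 hn hR
  have hn0 : n ≠ 0 := by
    rintro rfl
    simp [jacobiDivisorSum] at hR
  have hI0 : I ≠ ⊥ := by
    rintro rfl
    rw [Ideal.absNorm_bot] at hI
    exact hn0 hI.symm
  have hprin : I.IsPrincipal := by
    by_contra hI'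
    by_cases hAp : A.Prime
    · apply hI'
      refine h.isPrincipal_of_sq_isPrincipal hAp hI0 ?_
      rw [sq]
      exact isPrincipal_mul_of_classNumber_le_two hclass hI0 hI0 hI' hI'
    · have hAo : Odd A := Nat.odd_iff.2 (by omega)
      obtain ⟨p, ℓ, hp, hpA, hℓ, hℓ2, h1, h2⟩ :=
        exists_prime_jacobiSym_eq hsf hAo (by omega) hAp
      have hp2 : p ≠ 2 := by
        rintro rfl
        omega
      have hns : ¬ IsSquare ((ℓ : ℕ) : ZMod p) := by
        simpa using ZMod.nonsquare_of_jacobiSym_eq_neg_one h2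
      obtain ⟨L, hL⟩ := h.exists_absNorm_eq_prime hA4 hℓ (by omega) h1
      have hL0 : L ≠ ⊥ := by
        rintro rfl
        rw [Ideal.absNorm_bot] at hL
        exact hℓ.ne_zero hL.symm
      have hL' : ¬ L.IsPrincipal := fun hL' =>
        hns (hL ▸ h.isSquare_absNorm_of_isPrincipal hp hp2 hpA hL')
      have h3 := h.isSquare_absNorm_of_isPrincipal hp hp2 hpA
        (isPrincipal_mul_of_classNumber_le_two hclass hI0 hL0 hI' hL')
      have hnp : ((n : ℕ) : ZMod p) = 1 := by
        exact_mod_cast (ZMod.natCast_eq_natCast_iff n 1 p).2 (hn1.of_dvd hpA)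
      rw [map_mul, hI, hL, Nat.cast_mul, hnp, one_mul] at h3
      exact hns h3
  obtain ⟨z, rfl⟩ := hprin
  refine ⟨z, ?_⟩
  rw [← hI]
  change _ = ((Ideal.absNorm (Ideal.span {z}) : ℕ) : ℤ)
  rw [Ideal.absNorm_span_singleton, Int.natAbs_of_nonneg (h.norm_nonneg z)]

end QuadraticNormEquation

theorem coprime_two_mul_of_coprime_primorial {A w n : ℕ} (hsf : Squarefree A) (hA : Odd A)
    (hwA : A ≤ w) (hw : 2 ≤ w) (hn : n.Coprime (primorial w)) : n.Coprime (2 * A) := by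
  refine Nat.Coprime.coprime_dvd_right ?_ hn
  refine Nat.Coprime.mul_dvd_of_dvd_of_dvd hA.coprime_two_left ?_ ?_
  · exact (Nat.Prime.dvd_primorial_iff Nat.prime_two).2 hw
  · exact hsf.dvd_primorial.trans (primorial_dvd_primorial hwA)

theorem tendsto_ncard_div_of_card_compl_le {P : ℕ → Prop} {E : ℕ → ℕ → Prop} {δ : ℕ → ℝ}
    [∀ N, DecidablePred (E N)] (hδ : Tendsto δ atTop (nhds 0))
    (hE : ∀ᶠ N in atTop, (((Finset.range (N + 1)).filter (E N)).card : ℝ) ≤ N * δ N)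
    (hP : ∀ᶠ N in atTop, ∀ k, 1 ≤ k → ¬ E N k → P k) :
    Tendsto (fun N : ℕ => ({k : ℕ | 1 ≤ k ∧ k ≤ N ∧ P k}.ncard : ℝ) / N) atTop (nhds 1) := by
  have hlow : Tendsto (fun N => 1 - δ N) atTop (nhds 1) := by
    simpa using hδ.const_sub 1
  have hfin : ∀ N, {k : ℕ | 1 ≤ k ∧ k ≤ N ∧ P k}.Finite := fun N =>
    (Set.finite_Icc 1 N).subset fun k hk => ⟨hk.1, hk.2.1⟩
  refine tendsto_of_tendsto_of_tendsto_of_le_of_le' hlow tendsto_const_nhds ?_ ?_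
  · filter_upwards [hE, hP, eventually_ge_atTop 1] with N hN hN' hN1
    have hN0 : (0 : ℝ) < N := by exact_mod_cast hN1
    rw [le_div_iff₀ hN0]
    have h1 : N ≤ {k : ℕ | 1 ≤ k ∧ k ≤ N ∧ P k}.ncard +
        ((Finset.range (N + 1)).filter (E N)).card := by
      calc N = (Set.Icc 1 N).ncard := by
            rw [← Finset.coe_Icc, Set.ncard_coe_finset, Nat.card_Icc, Nat.add_sub_cancel]
        _ ≤ ({k : ℕ | 1 ≤ k ∧ k ≤ N ∧ P k} ∪
              ((Finset.range (N + 1)).filter (E N) : Set ℕ)).ncard := by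
            refine Set.ncard_le_ncard ?_ ((hfin N).union (Finset.finite_toSet _))
            intro k hk
            by_cases hk' : E N k
            · right
              have := hk.2
              simp only [Finset.coe_filter, Finset.mem_range]
              exact ⟨by omega, hk'⟩
            · exact Or.inl ⟨hk.1, hk.2, hN' k hk.1 hk'⟩
        _ ≤ _ := by
            rw [← Set.ncard_coe_finset]
            exact Set.ncard_union_le _ _
    have h2 : (N : ℝ) ≤ {k : ℕ | 1 ≤ k ∧ k ≤ N ∧ P k}.ncard +
        (((Finset.range (N + 1)).filter (E N)).card : ℝ) := by exact_mod_cast h1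
    linarith
  · filter_upwards with N
    refine div_le_one_of_le₀ ?_ N.cast_nonneg
    have : {k : ℕ | 1 ≤ k ∧ k ≤ N ∧ P k}.ncard ≤ (Set.Icc 1 N).ncard :=
      Set.ncard_le_ncard (fun k hk => ⟨hk.1, hk.2.1⟩) (Set.finite_Icc 1 N)
    rw [← Finset.coe_Icc, Set.ncard_coe_finset, Nat.card_Icc, Nat.add_sub_cancel] at this
    exact_mod_cast this

/-- Let `a` be a negative squarefree integer with `a ≡ 1 (mod 4)` (equivalently, `2` does not
ramify in the ring of integers `O` of `ℚ(√a)`), such that the class number of `ℚ(√a)` is at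
most `2`, and let `r` be a prime such that `p ≢ 1 (mod r)` for every prime `p ∣ a`. Here
`ℚ(√a)` is formalised as a number field `K` of degree `2` over `ℚ` containing a square root
of `a`. Then the set of positive integers `k` for which there exist `z ∈ O` and `t ∈ ℤ` with
`N_{ℚ(√a)/ℚ}(z) = t^r + k ≠ 0` has natural density `1`. -/
theorem chatelet_integral_points_density_one
    (a : ℤ) (ha_neg : a < 0) (hsf : Squarefree a) (ha4 : a % 4 = 1)
    (r : ℕ) (hr : r.Prime)
    (hp : ∀ p : ℕ, p.Prime → (p : ℤ) ∣ a → ¬ p ≡ 1 [MOD r])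
    (K : Type) [Field K] [NumberField K]
    (hdeg : Module.finrank ℚ K = 2) (α : K) (hα : α ^ 2 = (a : K))
    (hclass : NumberField.classNumber K ≤ 2) :
    Tendsto (fun N : ℕ =>
        ({k : ℕ | 1 ≤ k ∧ k ≤ N ∧
            ∃ (z : NumberField.RingOfIntegers K) (t : ℤ),
              Algebra.norm ℤ z = t ^ r + (k : ℤ) ∧ t ^ r + (k : ℤ) ≠ 0}.ncard : ℝ) / N)
      atTop (nhds 1) := by
  classical
  obtain ⟨δ, hδ⟩ := exists_hasHalfIntegerCoords ha_neg hsf ha4 hdeg hα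
  have hA4 : a.natAbs % 4 = 3 := by omega
  have hA : Squarefree a.natAbs := Int.squarefree_natAbs.2 hsf
  obtain ⟨w, ε, hw, hε, hcard⟩ := exists_card_sieveExceptional_le hA hA4 hr
    fun p hp' hpA => hp p hp' (Int.natCast_dvd.2 hpA)
  refine tendsto_ncard_div_of_card_compl_le hε hcard ?_
  filter_upwards [hw.eventually_ge_atTop 2, hw.eventually_ge_atTop a.natAbs] with N hN2 hNA k hk hE
  simp only [SieveExceptional, not_forall] at hE
  obtain ⟨t, hcop, hmod, hR⟩ := hE
  obtain ⟨z, hz⟩ := hδ.exists_norm_eq hA4 hA hclass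
    (coprime_two_mul_of_coprime_primorial hA (Nat.odd_iff.2 (by omega)) hNA hN2 hcop) hmod hR
  refine ⟨z, t, ?_, ?_⟩
  · rw [hz]
    push_cast
    ring
  · positivity
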